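/- arXiv:1102.4250 — 3 statements merged into one kernel-verified Lean document; each statement's English description precedes it below -/
import Mathlib

section
/- Let m, n ≥ 1 and V = mV_1 ⊕ nV_2 with coordinates (ℓ_1,…,ℓ_m, q_1,…,q_n). The invariant ring R = O(V)^{SL(2,ℂ)} is generated as a ℂ-algebra by: the degree-2 invariants (ℓ_i,ℓ_j)_1 for i < j and (q_i,q_j)_2 for i ≤ j; the degree-3 invariants (q_k, ℓ_i ℓ_j)_2 for i ≤ j and all k, and (q_i,(q_j,q_k)_1)_2 for i < j < k; and the degree-4 invariants ((q_i,q_j)_1, ℓ_k ℓ_l)_2 for i < j and k ≤ l. Moreover, the minimal number of generators of R equals C(n,3) + C(m+1,2)·C(n+1,2) + C(m,2) + C(n+1,2). -/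
open MvPolynomial

noncomputable section

namespace BinInv

/-- `k`-fold partial derivative with respect to the variable `v`. -/
def pd {A : Type*} [CommSemiring A] (v : Fin 2) (k : ℕ)
    (f : MvPolynomial (Fin 2) A) : MvPolynomial (Fin 2) A :=
  (fun g => MvPolynomial.pderiv v g)^[k] f

/-- The `p`-th transvectant of binary forms `g`, `h` of degrees `m`, `n`,
with coefficients in a commutative `ℂ`-algebra `A`. -/
def transvectant {A : Type*} [CommRing A] [Algebra ℂ A] (m n p : ℕ)
    (g h : MvPolynomial (Fin 2) A) : MvPolynomial (Fin 2) A :=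
  algebraMap ℂ (MvPolynomial (Fin 2) A)
      ((((m - p).factorial * (n - p).factorial : ℕ) : ℂ) /
        (((m.factorial * n.factorial : ℕ)) : ℂ)) *
    ∑ i ∈ Finset.range (p + 1),
      algebraMap ℂ (MvPolynomial (Fin 2) A) ((-1 : ℂ) ^ i * (p.choose i : ℂ)) *
        (pd 0 (p - i) (pd 1 i g) * pd 0 i (pd 1 (p - i) h))

variable {p : ℕ}

/-- Index type for the coefficients of a system of binary forms of degrees `n 0, …, n (p-1)`:
the space `V = V_{n 0} ⊕ … ⊕ V_{n (p-1)}` is identified with `Idx n → ℂ`. -/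
abbrev Idx (n : Fin p → ℕ) : Type := Σ i : Fin p, Fin (n i + 1)

/-- The binary form of degree `n i` with coefficient vector `c`. -/
def formAt (n : Fin p → ℕ) (c : Idx n → ℂ) (i : Fin p) : MvPolynomial (Fin 2) ℂ :=
  ∑ k : Fin (n i + 1), C (c ⟨i, k⟩) * X 0 ^ (n i - (k : ℕ)) * X 1 ^ (k : ℕ)

/-- The substitution action of `SL(2,ℂ)` on binary forms: `(g • f)(v) = f (g⁻¹ • v)`. -/
def sl2Act (g : Matrix.SpecialLinearGroup (Fin 2) ℂ) (f : MvPolynomial (Fin 2) ℂ) :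
    MvPolynomial (Fin 2) ℂ :=
  aeval (fun i => ∑ j, C ((↑(g⁻¹) : Matrix (Fin 2) (Fin 2) ℂ) i j) * X j) f

/-- The coefficient of `x^(n-k) y^k` in a binary form. -/
def coeffAt (n : Fin p → ℕ) (j : Idx n) (f : MvPolynomial (Fin 2) ℂ) : ℂ :=
  MvPolynomial.coeff
    (Finsupp.single 0 (n j.1 - (j.2 : ℕ)) + Finsupp.single 1 (j.2 : ℕ)) f

/-- The induced action of `SL(2,ℂ)` on points of `V`, in coefficient coordinates. -/
def actPt (n : Fin p → ℕ) (g : Matrix.SpecialLinearGroup (Fin 2) ℂ) (c : Idx n → ℂ) :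
    Idx n → ℂ :=
  fun j => coeffAt n j (sl2Act g (formAt n c j.1))

/-- A polynomial function on `V` is invariant if it is constant on `SL(2,ℂ)`-orbits. -/
def IsInvariant (n : Fin p → ℕ) (P : MvPolynomial (Idx n) ℂ) : Prop :=
  ∀ (g : Matrix.SpecialLinearGroup (Fin 2) ℂ) (c : Idx n → ℂ),
    eval (actPt n g c) P = eval c P

/-- The invariant ring `R = O(V)^{SL(2,ℂ)}` as a subalgebra of `O(V)`. -/
def invariantRing (n : Fin p → ℕ) : Subalgebra ℂ (MvPolynomial (Idx n) ℂ) where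
  carrier := {P | IsInvariant n P}
  mul_mem' := fun ha hb g c => by
    simp only [map_mul]; rw [ha g c, hb g c]
  one_mem' := fun g c => by simp
  add_mem' := fun ha hb g c => by
    simp only [map_add]; rw [ha g c, hb g c]
  zero_mem' := fun g c => by simp
  algebraMap_mem' := fun r g c => by simp

/-- The nullcone: the points of `V` where every homogeneous invariant of positive
degree vanishes. -/
def Nullcone (n : Fin p → ℕ) : Set (Idx n → ℂ) :=
  {c | ∀ P ∈ invariantRing n, ∀ d : ℕ, 0 < d → P.IsHomogeneous d → eval c P = 0}

/-- `P` is a homogeneous system of parameters of the invariant ring, with degrees `d`: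
the `P j` are homogeneous invariants of positive degrees `d j`, algebraically independent
over `ℂ`, and the invariant ring is integral over the subalgebra they generate. -/
def IsHSOP (n : Fin p → ℕ) {k : ℕ} (P : Fin k → MvPolynomial (Idx n) ℂ)
    (d : Fin k → ℕ) : Prop :=
  (∀ j, P j ∈ invariantRing n) ∧ (∀ j, 0 < d j) ∧
    (∀ j, (P j).IsHomogeneous (d j)) ∧ AlgebraicIndependent ℂ P ∧
    ∀ x ∈ invariantRing n, IsIntegral (↥(Algebra.adjoin ℂ (Set.range P))) x

/-- `r` is the minimal number of generators of the invariant ring. -/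
def IsMinimalNumGens (n : Fin p → ℕ) (r : ℕ) : Prop :=
  IsLeast {k | ∃ S : Finset (MvPolynomial (Idx n) ℂ),
    S.card = k ∧ Algebra.adjoin ℂ (S : Set (MvPolynomial (Idx n) ℂ)) = invariantRing n} r

/-- The invariant ring has minimal number of generators `r`, realized by a minimal
system of homogeneous generators of degrees `d 0, …, d (r-1)`. -/
def HasMinimalGens (n : Fin p → ℕ) {r : ℕ} (d : Fin r → ℕ) : Prop :=
  IsMinimalNumGens n r ∧
    ∃ G : Fin r → MvPolynomial (Idx n) ℂ, Function.Injective G ∧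
      (∀ j, (G j).IsHomogeneous (d j)) ∧
      Algebra.adjoin ℂ (Set.range G) = invariantRing n

/-- The generic binary form of degree `n i`, whose coefficients are the corresponding
coordinate functions on `V`. -/
def genForm (n : Fin p → ℕ) (i : Fin p) :
    MvPolynomial (Fin 2) (MvPolynomial (Idx n) ℂ) :=
  ∑ k : Fin (n i + 1), C (X ⟨i, k⟩) * X 0 ^ (n i - (k : ℕ)) * X 1 ^ (k : ℕ)

end BinInv

end

noncomputable section
namespace BinInv

/-- Degree vector of `V = m·V₁ ⊕ n·V₂`. -/
def mixedDeg (m n : ℕ) : Fin (m + n) → ℕ := fun i => if (i : ℕ) < m then 1 else 2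

/-- The `i`-th generic linear form `ℓᵢ` of `V = m·V₁ ⊕ n·V₂`. -/
def Lform (m n : ℕ) (i : Fin m) :
    MvPolynomial (Fin 2) (MvPolynomial (Idx (mixedDeg m n)) ℂ) :=
  genForm (mixedDeg m n) (Fin.castAdd n i)

/-- The `j`-th generic quadratic form `qⱼ` of `V = m·V₁ ⊕ n·V₂`. -/
def Qform (m n : ℕ) (j : Fin n) :
    MvPolynomial (Fin 2) (MvPolynomial (Idx (mixedDeg m n)) ℂ) :=
  genForm (mixedDeg m n) (Fin.natAdd m j)

end BinInv

namespace BinInv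

section Coordinates

variable {m n : ℕ}

theorem mixedDeg_castAdd (i : Fin m) : mixedDeg m n (Fin.castAdd n i) = 1 := by
  simp [mixedDeg]

theorem mixedDeg_natAdd (j : Fin n) : mixedDeg m n (Fin.natAdd m j) = 2 := by
  simp [mixedDeg]

/-- The index of the `k`-th coefficient of the `i`-th linear form. -/
def linIdx (i : Fin m) (k : Fin 2) : Idx (mixedDeg m n) :=
  ⟨Fin.castAdd n i, Fin.cast (by rw [mixedDeg_castAdd]) k⟩

/-- The index of the `k`-th coefficient of the `j`-th quadratic form. -/
def quadIdx (j : Fin n) (k : Fin 3) : Idx (mixedDeg m n) :=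
  ⟨Fin.natAdd m j, Fin.cast (by rw [mixedDeg_natAdd]) k⟩

theorem idx_cases {motive : Idx (mixedDeg m n) → Prop}
    (lin : ∀ i k, motive (linIdx i k)) (quad : ∀ j k, motive (quadIdx j k)) (a) : motive a := by
  obtain ⟨i, k⟩ := a
  induction i using Fin.addCases with
  | left i => exact lin i (Fin.cast (by rw [mixedDeg_castAdd]) k)
  | right j => exact quad j (Fin.cast (by rw [mixedDeg_natAdd]) k)

theorem linIdx_inj {i i' : Fin m} {k k' : Fin 2} :
    (linIdx i k : Idx (mixedDeg m n)) = linIdx i' k' ↔ i = i' ∧ k = k' := by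
  constructor
  · intro h
    obtain rfl : i = i' := by
      simpa [Fin.ext_iff, linIdx] using congrArg (fun a : Idx (mixedDeg m n) => (a.1 : ℕ)) h
    simpa [linIdx, Fin.ext_iff] using h
  · rintro ⟨rfl, rfl⟩; rfl

theorem quadIdx_inj {j j' : Fin n} {k k' : Fin 3} :
    (quadIdx j k : Idx (mixedDeg m n)) = quadIdx j' k' ↔ j = j' ∧ k = k' := by
  constructor
  · intro h
    obtain rfl : j = j' := by
      simpa [Fin.ext_iff, quadIdx] using congrArg (fun a : Idx (mixedDeg m n) => (a.1 : ℕ)) h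
    simpa [quadIdx, Fin.ext_iff] using h
  · rintro ⟨rfl, rfl⟩; rfl

theorem linIdx_ne_quadIdx (i : Fin m) (k : Fin 2) (j : Fin n) (l : Fin 3) :
    (linIdx i k : Idx (mixedDeg m n)) ≠ quadIdx j l := by
  intro h
  have := congrArg (fun a : Idx (mixedDeg m n) => (a.1 : ℕ)) h
  simp [linIdx, quadIdx] at this
  omega

theorem idx_bijective : Function.Bijective
    (Sum.elim (fun p : Fin m × Fin 2 => linIdx p.1 p.2)
      (fun p : Fin n × Fin 3 => (quadIdx p.1 p.2 : Idx (mixedDeg m n)))) := by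
  constructor
  · rintro (⟨i, k⟩ | ⟨j, l⟩) (⟨i', k'⟩ | ⟨j', l'⟩) h
    · simpa [linIdx_inj] using h
    · exact (linIdx_ne_quadIdx _ _ _ _ h).elim
    · exact (linIdx_ne_quadIdx _ _ _ _ h.symm).elim
    · simpa [quadIdx_inj] using h
  · exact idx_cases (fun i k => ⟨.inl (i, k), rfl⟩) (fun j k => ⟨.inr (j, k), rfl⟩)

/-- A function on coefficient indices given by its values on the coefficients of the linear
forms and of the quadratic forms. -/
def idxElim {B : Type*} (f : Fin m → Fin 2 → B) (g : Fin n → Fin 3 → B)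
    (a : Idx (mixedDeg m n)) : B :=
  Sum.elim (fun p => f p.1 p.2) (fun p => g p.1 p.2) ((Equiv.ofBijective _ idx_bijective).symm a)

@[simp]
theorem idxElim_linIdx {B : Type*} (f : Fin m → Fin 2 → B) (g : Fin n → Fin 3 → B) (i k) :
    idxElim f g (linIdx i k) = f i k := by
  have : (Equiv.ofBijective _ (idx_bijective (m := m) (n := n))).symm (linIdx i k)
      = .inl (i, k) := by
    rw [Equiv.symm_apply_eq]; rfl
  simp [idxElim, this]

@[simp]
theorem idxElim_quadIdx {B : Type*} (f : Fin m → Fin 2 → B) (g : Fin n → Fin 3 → B) (j k) :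
    idxElim f g (quadIdx j k) = g j k := by
  have : (Equiv.ofBijective _ (idx_bijective (m := m) (n := n))).symm (quadIdx j k)
      = .inr (j, k) := by
    rw [Equiv.symm_apply_eq]; rfl
  simp [idxElim, this]

theorem sum_linear {B : Type*} [CommSemiring B] (c : Idx (mixedDeg m n) → B) (i : Fin m) :
    ∑ k : Fin (mixedDeg m n (Fin.castAdd n i) + 1), C (c ⟨Fin.castAdd n i, k⟩) *
        X 0 ^ (mixedDeg m n (Fin.castAdd n i) - (k : ℕ)) * X 1 ^ (k : ℕ) =
      (C (c (linIdx i 0)) * X 0 + C (c (linIdx i 1)) * X 1 : MvPolynomial (Fin 2) B) := by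
  rw [← (finCongr (show 1 + 1 = _ by rw [mixedDeg_castAdd])).sum_comp]
  simp [Fin.sum_univ_two, mixedDeg_castAdd, linIdx]

theorem sum_quadratic {B : Type*} [CommSemiring B] (c : Idx (mixedDeg m n) → B) (j : Fin n) :
    ∑ k : Fin (mixedDeg m n (Fin.natAdd m j) + 1), C (c ⟨Fin.natAdd m j, k⟩) *
        X 0 ^ (mixedDeg m n (Fin.natAdd m j) - (k : ℕ)) * X 1 ^ (k : ℕ) =
      (C (c (quadIdx j 0)) * X 0 ^ 2 + C (c (quadIdx j 1)) * X 0 * X 1 +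
        C (c (quadIdx j 2)) * X 1 ^ 2 : MvPolynomial (Fin 2) B) := by
  rw [← (finCongr (show 2 + 1 = _ by rw [mixedDeg_natAdd])).sum_comp]
  simp [Fin.sum_univ_three, mixedDeg_natAdd, quadIdx]

end Coordinates

section Forms

variable {B : Type*} [CommRing B]

/-- The binary linear form with coefficients `a`, `b`. -/
def linForm (a b : B) : MvPolynomial (Fin 2) B := C a * X 0 + C b * X 1

/-- The binary quadratic form with coefficients `a`, `b`, `c`. -/
def quadForm (a b c : B) : MvPolynomial (Fin 2) B :=
  C a * X 0 ^ 2 + C b * X 0 * X 1 + C c * X 1 ^ 2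

theorem linForm_mul (a b c d : B) :
    linForm a b * linForm c d = quadForm (a * c) (a * d + b * c) (b * d) := by
  simp only [linForm, quadForm, C_mul, C_add]; ring

theorem pderiv_two (i : Fin 2) : pderiv i (2 : MvPolynomial (Fin 2) B) = 0 :=
  Derivation.map_natCast _ 2

variable [Algebra ℂ B]

theorem C_half_mul_two :
    C (algebraMap ℂ B 2⁻¹) * 2 = (1 : MvPolynomial (Fin 2) B) := by
  rw [show (2 : MvPolynomial (Fin 2) B) = C (algebraMap ℂ B 2) by
    rw [map_ofNat, map_ofNat], ← C_mul, ← map_mul]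
  simp

theorem C_quarter :
    C (algebraMap ℂ B 4⁻¹) =
      (C (algebraMap ℂ B 2⁻¹) * C (algebraMap ℂ B 2⁻¹) : MvPolynomial (Fin 2) B) := by
  rw [← C_mul, ← map_mul]; norm_num

theorem transvectant_linForm (a b c d : B) :
    transvectant 1 1 1 (linForm a b) (linForm c d) = C (a * d - b * c) := by
  simp [transvectant, pd, linForm, Finset.sum_range_succ, pderiv_X]
  ring

theorem transvectant_quadForm_two (a b c a' b' c' : B) :
    transvectant 2 2 2 (quadForm a b c) (quadForm a' b' c') =
      C (a * c' + c * a' - algebraMap ℂ B (1 / 2) * (b * b')) := by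
  have h := C_half_mul_two (B := B)
  simp [transvectant, pd, quadForm, Finset.sum_range_succ, pderiv_X, pderiv_two, C_quarter]
  generalize (C (algebraMap ℂ B 2⁻¹) : MvPolynomial (Fin 2) B) = t at h ⊢
  linear_combination ((2 * t + 1) * (C a * C c' + C c * C a') - t * (C b * C b')) * h

theorem transvectant_quadForm_one (a b c a' b' c' : B) :
    transvectant 2 2 1 (quadForm a b c) (quadForm a' b' c') =
      quadForm (algebraMap ℂ B (1 / 2) * (a * b' - b * a')) (a * c' - c * a')
        (algebraMap ℂ B (1 / 2) * (b * c' - c * b')) := by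
  have h := C_half_mul_two (B := B)
  simp [transvectant, pd, quadForm, Finset.sum_range_succ, pderiv_X, C_quarter]
  generalize (C (algebraMap ℂ B 2⁻¹) : MvPolynomial (Fin 2) B) = t at h ⊢
  linear_combination (t * (C a * C b' - C b * C a') * X 0 ^ 2 +
    (2 * t + 1) * (C a * C c' - C c * C a') * X 0 * X 1 +
    t * (C b * C c' - C c * C b') * X 1 ^ 2) * h

end Forms

section Generators

variable {m n : ℕ}

variable (m n) in
/-- The coordinate ring of `m·V₁ ⊕ n·V₂`. -/
abbrev CoordRing : Type := MvPolynomial (Idx (mixedDeg m n)) ℂ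

/-- The `k`-th coefficient of `ℓᵢ` as a coordinate function. -/
def linCoord (i : Fin m) (k : Fin 2) : CoordRing m n := X (linIdx i k)

/-- The `k`-th coefficient of `qⱼ` as a coordinate function. -/
def quadCoord (j : Fin n) (k : Fin 3) : CoordRing m n := X (quadIdx j k)

theorem Lform_eq (i : Fin m) : Lform m n i = linForm (linCoord i 0) (linCoord i 1) :=
  sum_linear _ _

theorem Qform_eq (j : Fin n) :
    Qform m n j = quadForm (quadCoord j 0) (quadCoord j 1) (quadCoord j 2) :=
  sum_quadratic _ _

/-- The invariant `(ℓᵢ, ℓⱼ)₁`. -/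
def linLin (i j : Fin m) : CoordRing m n :=
  linCoord i 0 * linCoord j 1 - linCoord i 1 * linCoord j 0

/-- The invariant `(qᵢ, qⱼ)₂`. -/
def quadQuad (i j : Fin n) : CoordRing m n :=
  quadCoord i 0 * quadCoord j 2 + quadCoord i 2 * quadCoord j 0 -
    C (1 / 2) * (quadCoord i 1 * quadCoord j 1)

/-- The invariant `(q_k, ℓᵢ ℓⱼ)₂`. -/
def quadLinLin (k : Fin n) (i j : Fin m) : CoordRing m n :=
  quadCoord k 0 * (linCoord i 1 * linCoord j 1) + quadCoord k 2 * (linCoord i 0 * linCoord j 0) -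
    C (1 / 2) * (quadCoord k 1 * (linCoord i 0 * linCoord j 1 + linCoord i 1 * linCoord j 0))

/-- The invariant `(qᵢ, (qⱼ, q_k)₁)₂`. -/
def quadTriple (i j k : Fin n) : CoordRing m n :=
  quadCoord i 0 * (C (1 / 2) * (quadCoord j 1 * quadCoord k 2 - quadCoord j 2 * quadCoord k 1)) +
    quadCoord i 2 * (C (1 / 2) * (quadCoord j 0 * quadCoord k 1 - quadCoord j 1 * quadCoord k 0)) -
    C (1 / 2) * (quadCoord i 1 * (quadCoord j 0 * quadCoord k 2 - quadCoord j 2 * quadCoord k 0))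

/-- The invariant `((qᵢ, qⱼ)₁, ℓ_k ℓ_l)₂`. -/
def quadQuadLinLin (i j : Fin n) (k l : Fin m) : CoordRing m n :=
  C (1 / 2) * (quadCoord i 0 * quadCoord j 1 - quadCoord i 1 * quadCoord j 0) *
      (linCoord k 1 * linCoord l 1) +
    C (1 / 2) * (quadCoord i 1 * quadCoord j 2 - quadCoord i 2 * quadCoord j 1) *
      (linCoord k 0 * linCoord l 0) -
    C (1 / 2) * ((quadCoord i 0 * quadCoord j 2 - quadCoord i 2 * quadCoord j 0) *
      (linCoord k 0 * linCoord l 1 + linCoord k 1 * linCoord l 0))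

variable (m n) in
/-- The index set of the system of generators. -/
abbrev GenIdx : Type :=
  {p : Fin m × Fin m // p.1 < p.2} ⊕ {p : Fin n × Fin n // p.1 ≤ p.2} ⊕
    (Fin n × {p : Fin m × Fin m // p.1 ≤ p.2}) ⊕
    {p : Fin n × Fin n × Fin n // p.1 < p.2.1 ∧ p.2.1 < p.2.2} ⊕
    ({p : Fin n × Fin n // p.1 < p.2} × {p : Fin m × Fin m // p.1 ≤ p.2})

/-- The system of generators of the invariant ring. -/
def gen : GenIdx m n → CoordRing m n
  | .inl p => linLin p.1.1 p.1.2
  | .inr (.inl p) => quadQuad p.1.1 p.1.2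
  | .inr (.inr (.inl p)) => quadLinLin p.1 p.2.1.1 p.2.1.2
  | .inr (.inr (.inr (.inl p))) => quadTriple p.1.1 p.1.2.1 p.1.2.2
  | .inr (.inr (.inr (.inr p))) => quadQuadLinLin p.1.1.1 p.1.1.2 p.2.1.1 p.2.1.2

theorem transvectant_generators_eq_range_gen :
    {P : MvPolynomial (Idx (mixedDeg m n)) ℂ |
          (∃ i j : Fin m, i < j ∧
            P = constantCoeff (transvectant 1 1 1 (Lform m n i) (Lform m n j))) ∨
          (∃ i j : Fin n, i ≤ j ∧
            P = constantCoeff (transvectant 2 2 2 (Qform m n i) (Qform m n j))) ∨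
          (∃ (k : Fin n) (i j : Fin m), i ≤ j ∧
            P = constantCoeff (transvectant 2 2 2 (Qform m n k) (Lform m n i * Lform m n j))) ∨
          (∃ i j k : Fin n, i < j ∧ j < k ∧
            P = constantCoeff (transvectant 2 2 2 (Qform m n i)
              (transvectant 2 2 1 (Qform m n j) (Qform m n k)))) ∨
          (∃ (i j : Fin n) (k l : Fin m), i < j ∧ k ≤ l ∧
            P = constantCoeff (transvectant 2 2 2
              (transvectant 2 2 1 (Qform m n i) (Qform m n j))
              (Lform m n k * Lform m n l)))} = Set.range gen := by
  simp only [Lform_eq, Qform_eq, linForm_mul, transvectant_linForm, transvectant_quadForm_one,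
    transvectant_quadForm_two, constantCoeff_C, algebraMap_eq]
  ext P
  constructor
  · rintro (⟨i, j, h, rfl⟩ | ⟨i, j, h, rfl⟩ | ⟨k, i, j, h, rfl⟩ | ⟨i, j, k, h, h', rfl⟩ |
      ⟨i, j, k, l, h, h', rfl⟩)
    · exact ⟨.inl ⟨(i, j), h⟩, rfl⟩
    · exact ⟨.inr (.inl ⟨(i, j), h⟩), rfl⟩
    · exact ⟨.inr (.inr (.inl (k, ⟨(i, j), h⟩))), rfl⟩
    · exact ⟨.inr (.inr (.inr (.inl ⟨(i, j, k), h, h'⟩))), rfl⟩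
    · exact ⟨.inr (.inr (.inr (.inr (⟨(i, j), h⟩, ⟨(k, l), h'⟩)))), rfl⟩
  · rintro ⟨⟨⟨i, j⟩, h⟩ | ⟨⟨i, j⟩, h⟩ | ⟨k, ⟨i, j⟩, h⟩ | ⟨⟨i, j, k⟩, h, h'⟩ |
      ⟨⟨⟨i, j⟩, h⟩, ⟨k, l⟩, h'⟩, rfl⟩
    · exact .inl ⟨i, j, h, rfl⟩
    · exact .inr (.inl ⟨i, j, h, rfl⟩)
    · exact .inr (.inr (.inl ⟨k, i, j, h, rfl⟩))
    · exact .inr (.inr (.inr (.inl ⟨i, j, k, h, h', rfl⟩)))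
    · exact .inr (.inr (.inr (.inr ⟨i, j, k, l, h, h', rfl⟩)))

end Generators

section Action

variable {m n : ℕ}

theorem coeffAt_linIdx (a b : ℂ) (i : Fin m) (k : Fin 2) :
    coeffAt (mixedDeg m n) (linIdx i k) (linForm a b) = ![a, b] k := by
  fin_cases k <;>
  simp [coeffAt, linIdx, linForm, mixedDeg_castAdd, coeff_C_mul, coeff_X, Finsupp.single_left_inj]

theorem coeffAt_quadIdx (a b c : ℂ) (j : Fin n) (k : Fin 3) :
    coeffAt (mixedDeg m n) (quadIdx j k) (quadForm a b c) = ![a, b, c] k := by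
  have h : ∀ r s : ℕ, (X 0 ^ r * X 1 ^ s : MvPolynomial (Fin 2) ℂ) =
      monomial (Finsupp.single 0 r + Finsupp.single 1 s) 1 := fun r s => by
    rw [X_pow_eq_monomial, X_pow_eq_monomial, monomial_mul, one_mul]
  have e : quadForm a b c = C a * (X 0 ^ 2 * X 1 ^ 0) + C b * (X 0 ^ 1 * X 1 ^ 1) +
      C c * (X 0 ^ 0 * X 1 ^ 2) := by
    simp only [quadForm]; ring
  have d : ∀ r s r' s' : ℕ, (Finsupp.single 0 r + Finsupp.single 1 s : Fin 2 →₀ ℕ) =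
      Finsupp.single 0 r' + Finsupp.single 1 s' ↔ r = r' ∧ s = s' := fun r s r' s' => by
    simp [Finsupp.ext_iff, Fin.forall_fin_two]
  rw [e, h, h, h]
  fin_cases k <;>
  simp [coeffAt, quadIdx, mixedDeg_natAdd, coeff_C_mul, coeff_monomial, d, -Finsupp.single_zero]

/-- The image of a point under the substitution of variables with matrix `Gᵀ`. -/
def substPt (G : Matrix (Fin 2) (Fin 2) ℂ) (c : Idx (mixedDeg m n) → ℂ) :
    Idx (mixedDeg m n) → ℂ :=
  idxElim (fun i k => G k 0 * c (linIdx i 0) + G k 1 * c (linIdx i 1))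
    (fun j => ![G 0 0 ^ 2 * c (quadIdx j 0) + G 0 0 * G 0 1 * c (quadIdx j 1) +
        G 0 1 ^ 2 * c (quadIdx j 2),
      2 * G 0 0 * G 1 0 * c (quadIdx j 0) + (G 0 0 * G 1 1 + G 0 1 * G 1 0) * c (quadIdx j 1) +
        2 * G 0 1 * G 1 1 * c (quadIdx j 2),
      G 1 0 ^ 2 * c (quadIdx j 0) + G 1 0 * G 1 1 * c (quadIdx j 1) +
        G 1 1 ^ 2 * c (quadIdx j 2)])

theorem actPt_eq_substPt (g : Matrix.SpecialLinearGroup (Fin 2) ℂ)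
    (c : Idx (mixedDeg m n) → ℂ) :
    actPt (mixedDeg m n) g c =
      substPt (Matrix.transpose (↑(g⁻¹) : Matrix (Fin 2) (Fin 2) ℂ)) c := by
  funext a
  induction a using idx_cases with
  | lin i k =>
    have h : sl2Act g (formAt (mixedDeg m n) c (linIdx i k : Idx (mixedDeg m n)).1) =
        linForm ((g⁻¹).1 0 0 * c (linIdx i 0) + (g⁻¹).1 1 0 * c (linIdx i 1))
          ((g⁻¹).1 0 1 * c (linIdx i 0) + (g⁻¹).1 1 1 * c (linIdx i 1)) := by
      rw [show formAt (mixedDeg m n) c (linIdx i k : Idx (mixedDeg m n)).1 = _ from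
        sum_linear c i]
      simp only [sl2Act, linForm, map_add, map_mul, aeval_X, aeval_C, Fin.sum_univ_two,
        algebraMap_eq]
      ring
    rw [actPt, h, coeffAt_linIdx]
    fin_cases k <;> simp [substPt]
  | quad j k =>
    have h : sl2Act g (formAt (mixedDeg m n) c (quadIdx j k : Idx (mixedDeg m n)).1) =
        quadForm ((g⁻¹).1 0 0 ^ 2 * c (quadIdx j 0) +
            (g⁻¹).1 0 0 * (g⁻¹).1 1 0 * c (quadIdx j 1) + (g⁻¹).1 1 0 ^ 2 * c (quadIdx j 2))
          (2 * (g⁻¹).1 0 0 * (g⁻¹).1 0 1 * c (quadIdx j 0) +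
            ((g⁻¹).1 0 0 * (g⁻¹).1 1 1 + (g⁻¹).1 1 0 * (g⁻¹).1 0 1) * c (quadIdx j 1) +
            2 * (g⁻¹).1 1 0 * (g⁻¹).1 1 1 * c (quadIdx j 2))
          ((g⁻¹).1 0 1 ^ 2 * c (quadIdx j 0) +
            (g⁻¹).1 0 1 * (g⁻¹).1 1 1 * c (quadIdx j 1) + (g⁻¹).1 1 1 ^ 2 * c (quadIdx j 2)) := by
      rw [show formAt (mixedDeg m n) c (quadIdx j k : Idx (mixedDeg m n)).1 = _ from
        sum_quadratic c j]
      simp only [sl2Act, quadForm, map_add, map_mul, map_pow, aeval_X, aeval_C, Fin.sum_univ_two,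
        algebraMap_eq, map_ofNat]
      ring
    rw [actPt, h, coeffAt_quadIdx]
    fin_cases k <;> simp [substPt]

theorem gen_mem_invariantRing (α : GenIdx m n) : gen α ∈ invariantRing (mixedDeg m n) := by
  intro g c
  have hdet : (↑(g⁻¹) : Matrix (Fin 2) (Fin 2) ℂ) 0 0 * (↑(g⁻¹) : Matrix (Fin 2) (Fin 2) ℂ) 1 1 -
      (↑(g⁻¹) : Matrix (Fin 2) (Fin 2) ℂ) 0 1 * (↑(g⁻¹) : Matrix (Fin 2) (Fin 2) ℂ) 1 0 = 1 := by
    rw [← Matrix.det_fin_two]; exact (g⁻¹).2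
  rw [actPt_eq_substPt]
  generalize (↑(g⁻¹) : Matrix (Fin 2) (Fin 2) ℂ) = h at *
  set D := h 0 0 * h 1 1 - h 0 1 * h 1 0 with hD
  suffices ∃ k : ℕ, eval (substPt h.transpose c) (gen α) = D ^ k * eval c (gen α) by
    obtain ⟨k, hk⟩ := this
    rw [hk, hdet, one_pow, one_mul]
  rcases α with ⟨⟨i, j⟩, -⟩ | ⟨⟨i, j⟩, -⟩ | ⟨k, ⟨i, j⟩, -⟩ | ⟨⟨i, j, k⟩, -⟩ |
      ⟨⟨⟨i, j⟩, -⟩, ⟨k, l⟩, -⟩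
  · use 1
    simp [gen, linLin, linCoord, substPt, D]; ring
  · use 2
    simp [gen, quadQuad, quadCoord, substPt, D]; ring
  · use 2
    simp [gen, quadLinLin, linCoord, quadCoord, substPt, D]; ring
  · use 3
    simp [gen, quadTriple, quadCoord, substPt, D]; ring
  · use 3
    simp [gen, quadQuadLinLin, linCoord, quadCoord, substPt, D]; ring

end Action

section CayleyOperator

variable {A : Type*} [CommRing A]

/-- Cayley's Omega operator `∂₀₀∂₁₁ - ∂₀₁∂₁₀` on polynomials in the entries of a generic
`2 × 2` matrix. -/
def cayleyOmega : MvPolynomial (Fin 2 × Fin 2) A →ₗ[A] MvPolynomial (Fin 2 × Fin 2) A :=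
  (pderiv (0, 0)).toLinearMap ∘ₗ (pderiv (1, 1)).toLinearMap -
    (pderiv (0, 1)).toLinearMap ∘ₗ (pderiv (1, 0)).toLinearMap

/-- The polarization of `cayleyOmega`, i.e. its failure to be a derivation. -/
def cayleyPolar (f h : MvPolynomial (Fin 2 × Fin 2) A) : MvPolynomial (Fin 2 × Fin 2) A :=
  pderiv (0, 0) f * pderiv (1, 1) h - pderiv (0, 1) f * pderiv (1, 0) h -
    pderiv (1, 0) f * pderiv (0, 1) h + pderiv (1, 1) f * pderiv (0, 0) h

theorem cayleyOmega_apply (f : MvPolynomial (Fin 2 × Fin 2) A) :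
    cayleyOmega f = pderiv (0, 0) (pderiv (1, 1) f) - pderiv (0, 1) (pderiv (1, 0) f) := rfl

theorem cayleyOmega_mul (f h : MvPolynomial (Fin 2 × Fin 2) A) :
    cayleyOmega (f * h) = cayleyOmega f * h + f * cayleyOmega h + cayleyPolar f h := by
  simp only [cayleyOmega_apply, cayleyPolar, pderiv_mul, map_add]
  ring

theorem cayleyPolar_comm (f h : MvPolynomial (Fin 2 × Fin 2) A) :
    cayleyPolar f h = cayleyPolar h f := by
  simp only [cayleyPolar]; ring

theorem cayleyPolar_add (f g h : MvPolynomial (Fin 2 × Fin 2) A) :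
    cayleyPolar f (g + h) = cayleyPolar f g + cayleyPolar f h := by
  simp only [cayleyPolar, map_add]; ring

theorem cayleyPolar_mul (f g h : MvPolynomial (Fin 2 × Fin 2) A) :
    cayleyPolar f (g * h) = cayleyPolar f g * h + g * cayleyPolar f h := by
  simp only [cayleyPolar, pderiv_mul]; ring

theorem cayleyPolar_C (f : MvPolynomial (Fin 2 × Fin 2) A) (a : A) :
    cayleyPolar f (C a) = 0 := by
  simp [cayleyPolar]

/-- The determinant of the generic `2 × 2` matrix. -/
def genericDet : MvPolynomial (Fin 2 × Fin 2) A := X (0, 0) * X (1, 1) - X (0, 1) * X (1, 0)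

theorem cayleyPolar_genericDet_pow (k : ℕ) :
    cayleyPolar genericDet (genericDet ^ k) =
      2 * (k : MvPolynomial (Fin 2 × Fin 2) A) * genericDet ^ k := by
  induction k with
  | zero => simpa using cayleyPolar_C genericDet (1 : A)
  | succ k ih =>
    have h : cayleyPolar genericDet genericDet =
        2 * (genericDet : MvPolynomial (Fin 2 × Fin 2) A) := by
      simp [cayleyPolar, genericDet, pderiv_X]; ring
    rw [pow_succ, cayleyPolar_mul, ih, h]
    push_cast; ring

theorem cayleyOmega_genericDet_pow (k : ℕ) :
    cayleyOmega (genericDet ^ (k + 1)) =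
      ((k + 1) * (k + 2) : ℕ) • (genericDet ^ k : MvPolynomial (Fin 2 × Fin 2) A) := by
  have h : cayleyOmega genericDet = (2 : MvPolynomial (Fin 2 × Fin 2) A) := by
    simp [cayleyOmega_apply, genericDet, pderiv_X]; ring
  induction k with
  | zero => simpa using h
  | succ k ih =>
    rw [pow_succ', cayleyOmega_mul, ih, h, cayleyPolar_genericDet_pow]
    simp only [nsmul_eq_mul]; push_cast; ring

theorem constantCoeff_cayleyOmega_iterate_genericDet_pow (N k : ℕ) :
    constantCoeff (cayleyOmega^[N] (genericDet ^ k : MvPolynomial (Fin 2 × Fin 2) A)) =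
      if k = N then ((N.factorial * (N + 1).factorial : ℕ) : A) else 0 := by
  induction N generalizing k with
  | zero => cases k <;> simp [genericDet]
  | succ N ih =>
    rw [Function.iterate_succ_apply]
    cases k with
    | zero =>
      have h : cayleyOmega (genericDet ^ 0 : MvPolynomial (Fin 2 × Fin 2) A) = 0 := by
        simp [cayleyOmega_apply]
      have h0 : cayleyOmega^[N] (0 : MvPolynomial (Fin 2 × Fin 2) A) = 0 := by
        rw [← Module.End.pow_apply, map_zero]
      rw [h, h0]; simp
    | succ k =>
      have h0 (f : MvPolynomial (Fin 2 × Fin 2) A) (r : ℕ) :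
          cayleyOmega^[N] (r • f) = r • cayleyOmega^[N] f := by
        rw [← Module.End.pow_apply, map_nsmul, Module.End.pow_apply]
      rw [cayleyOmega_genericDet_pow, h0, map_nsmul, ih]
      by_cases hk : k = N
      · subst hk
        simp only [if_true, nsmul_eq_mul, Nat.factorial_succ]; push_cast; ring
      · simp [hk]

theorem constantCoeff_cayleyOmega_iterate_eval₂ (e : Polynomial A) (N : ℕ) :
    constantCoeff (cayleyOmega^[N] (e.eval₂ C genericDet)) =
      ((N.factorial * (N + 1).factorial : ℕ) : A) * e.coeff N := by
  rw [← Module.End.pow_apply]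
  induction e using Polynomial.induction_on' with
  | add p q hp hq => rw [Polynomial.eval₂_add, map_add, map_add, hp, hq, Polynomial.coeff_add,
      mul_add]
  | monomial k a =>
    rw [Polynomial.eval₂_monomial, ← smul_eq_C_mul, map_smul, Module.End.pow_apply, smul_eq_C_mul,
      map_mul, constantCoeff_cayleyOmega_iterate_genericDet_pow, constantCoeff_C,
      Polynomial.coeff_monomial]
    split_ifs <;> ring

/-- The standard skew-symmetric matrix. -/
def skew : Matrix (Fin 2) (Fin 2) A := !![0, 1; -1, 0]

/-- The `r`-th entry of `G v` for the generic matrix `G`. -/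
def genericVec (v : Fin 2 → A) (r : Fin 2) : MvPolynomial (Fin 2 × Fin 2) A :=
  X (r, 0) * C (v 0) + X (r, 1) * C (v 1)

/-- The `(r, s)` entry of `G T Gᵀ` for the generic matrix `G`. -/
def genericTensor (T : Matrix (Fin 2) (Fin 2) A) (r s : Fin 2) : MvPolynomial (Fin 2 × Fin 2) A :=
  X (r, 0) * C (T 0 0) * X (s, 0) + X (r, 0) * C (T 0 1) * X (s, 1) +
    X (r, 1) * C (T 1 0) * X (s, 0) + X (r, 1) * C (T 1 1) * X (s, 1)

theorem cayleyOmega_genericVec (v : Fin 2 → A) (r : Fin 2) :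
    cayleyOmega (genericVec v r) = 0 := by
  fin_cases r <;> simp [cayleyOmega_apply, genericVec, pderiv_X]

theorem cayleyOmega_genericTensor (T : Matrix (Fin 2) (Fin 2) A) (r s : Fin 2) :
    cayleyOmega (genericTensor T r s) = C (skew r s * (T 0 1 - T 1 0)) := by
  fin_cases r <;> fin_cases s <;>
    simp [cayleyOmega_apply, genericTensor, pderiv_X, skew]

theorem cayleyPolar_genericVec_genericVec (v w : Fin 2 → A) (r s : Fin 2) :
    cayleyPolar (genericVec v r) (genericVec w s) =
      C (skew r s * (v 0 * w 1 - v 1 * w 0)) := by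
  fin_cases r <;> fin_cases s <;>
    simp [cayleyPolar, genericVec, pderiv_X, skew]
  all_goals ring

theorem cayleyPolar_genericVec_genericTensor (v : Fin 2 → A) (T : Matrix (Fin 2) (Fin 2) A)
    (r s t : Fin 2) :
    cayleyPolar (genericVec v r) (genericTensor T s t) =
      -(C (skew r s) * genericVec (T.transpose.mulVec (skew.mulVec v)) t) -
        C (skew r t) * genericVec (T.mulVec (skew.mulVec v)) s := by
  fin_cases r <;> fin_cases s <;> fin_cases t <;>
    simp [cayleyPolar, genericVec, genericTensor, pderiv_X, skew,
      Matrix.mulVec, dotProduct, Fin.sum_univ_two] <;> ring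

theorem cayleyPolar_genericTensor_genericTensor (T U : Matrix (Fin 2) (Fin 2) A)
    (r s t u : Fin 2) :
    cayleyPolar (genericTensor T r s) (genericTensor U t u) =
      C (skew r t) * genericTensor (T.transpose * skew * U) s u +
      C (skew r u) * genericTensor (T.transpose * skew * U.transpose) s t +
      C (skew s t) * genericTensor (T * skew * U) r u +
      C (skew s u) * genericTensor (T * skew * U.transpose) r t := by
  have hT : genericTensor T r s = genericVec (Pi.single 0 1) r * genericVec (T 0) s +
      genericVec (Pi.single 1 1) r * genericVec (T 1) s := by
    simp [genericTensor, genericVec]; ring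
  rw [hT, cayleyPolar_comm, cayleyPolar_add, cayleyPolar_mul, cayleyPolar_mul]
  simp only [cayleyPolar_comm (genericTensor U t u), cayleyPolar_genericVec_genericTensor]
  simp [genericTensor, genericVec, skew, Matrix.mulVec, dotProduct, Matrix.mul_apply,
    Fin.sum_univ_two]
  ring

end CayleyOperator

section Closure

variable {A : Type*} [CommRing A]

theorem cayleyPolar_neg (f h : MvPolynomial (Fin 2 × Fin 2) A) :
    cayleyPolar f (-h) = -cayleyPolar f h := by
  rw [← neg_one_mul, ← C_1, ← C_neg, cayleyPolar_mul, cayleyPolar_C, C_neg, C_1]; ring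

theorem cayleyOmega_mem_closure {s : Set (MvPolynomial (Fin 2 × Fin 2) A)} {R₀ : Subring A}
    (hΩ : ∀ f ∈ s, cayleyOmega f ∈ Subring.closure (s ∪ C '' R₀))
    (hΓ : ∀ f ∈ s, ∀ h ∈ s, cayleyPolar f h ∈ Subring.closure (s ∪ C '' R₀))
    {f : MvPolynomial (Fin 2 × Fin 2) A} (hf : f ∈ Subring.closure (s ∪ C '' R₀)) :
    cayleyOmega f ∈ Subring.closure (s ∪ C '' R₀) := by
  have polar_of_gen {f : MvPolynomial (Fin 2 × Fin 2) A}
      (hf : ∀ h ∈ s, cayleyPolar f h ∈ Subring.closure (s ∪ C '' R₀))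
      {h : MvPolynomial (Fin 2 × Fin 2) A} (hh : h ∈ Subring.closure (s ∪ C '' R₀)) :
      cayleyPolar f h ∈ Subring.closure (s ∪ C '' R₀) := by
    induction hh using Subring.closure_induction with
    | mem x hx =>
      rcases hx with hx | ⟨a, -, rfl⟩
      · exact hf x hx
      · rw [cayleyPolar_C]; exact zero_mem _
    | zero => rw [← C_0, cayleyPolar_C]; exact zero_mem _
    | one => rw [← C_1, cayleyPolar_C]; exact zero_mem _
    | add x y _ _ hx hy => rw [cayleyPolar_add]; exact add_mem hx hy
    | neg x _ hx => rw [cayleyPolar_neg]; exact neg_mem hx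
    | mul x y hx' hy' hx hy =>
      rw [cayleyPolar_mul]
      exact add_mem (mul_mem hx hy') (mul_mem hx' hy)
  have polar {f h : MvPolynomial (Fin 2 × Fin 2) A} (hf : f ∈ Subring.closure (s ∪ C '' R₀))
      (hh : h ∈ Subring.closure (s ∪ C '' R₀)) :
      cayleyPolar f h ∈ Subring.closure (s ∪ C '' R₀) := by
    refine polar_of_gen (fun h hs => ?_) hh
    rw [cayleyPolar_comm]
    exact polar_of_gen (hΓ h hs) hf
  have hC (a : A) : cayleyOmega (C a : MvPolynomial (Fin 2 × Fin 2) A) = 0 := by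
    simp [cayleyOmega_apply]
  induction hf using Subring.closure_induction with
  | mem x hx =>
    rcases hx with hx | ⟨a, -, rfl⟩
    · exact hΩ x hx
    · rw [hC]; exact zero_mem _
  | zero => rw [map_zero]; exact zero_mem _
  | one => rw [← C_1, hC]; exact zero_mem _
  | add x y _ _ hx hy => rw [map_add]; exact add_mem hx hy
  | neg x _ hx => rw [map_neg]; exact neg_mem hx
  | mul x y hx' hy' hx hy =>
    rw [cayleyOmega_mul]
    exact add_mem (add_mem (mul_mem hx hy') (mul_mem hx' hy)) (polar hx' hy')

/-- If a family of vectors and tensors over `A` is closed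
under skew contraction up to scalars in `R₀`, then the coefficients of any polynomial in the
generic determinant lying in the ring generated by the transformed vectors and tensors
lie in `R₀`, up to a positive integer. -/
theorem factorial_mul_coeff_mem (R₀ : Subring A) (V : Set (Fin 2 → A))
    (T : Set (Matrix (Fin 2) (Fin 2) A))
    (hVV : ∀ v ∈ V, ∀ w ∈ V, v 0 * w 1 - v 1 * w 0 ∈ R₀)
    (hTV : ∀ t ∈ T, ∀ v ∈ V, t.mulVec (skew.mulVec v) ∈ V)
    (hT : ∀ t ∈ T, t.transpose ∈ T) (hTT : ∀ t ∈ T, ∀ u ∈ T, t * skew * u ∈ T)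
    (htr : ∀ t ∈ T, t 0 1 - t 1 0 ∈ R₀) {e : Polynomial A}
    (he : e.eval₂ C genericDet ∈ Subring.closure
      (({f | ∃ v ∈ V, ∃ r, f = genericVec v r} ∪ {f | ∃ t ∈ T, ∃ r s, f = genericTensor t r s}) ∪
        C '' R₀)) (N : ℕ) :
    ((N.factorial * (N + 1).factorial : ℕ) : A) * e.coeff N ∈ R₀ := by
  set s := {f | ∃ v ∈ V, ∃ r, f = genericVec v r} ∪ {f | ∃ t ∈ T, ∃ r s, f = genericTensor t r s}
    with hs
  have hskew (r s : Fin 2) : (skew r s : A) ∈ R₀ := by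
    fin_cases r <;> fin_cases s <;> simp [skew, one_mem, zero_mem]
  have hC {a : A} (ha : a ∈ R₀) : C a ∈ Subring.closure (s ∪ C '' R₀) :=
    Subring.subset_closure (.inr ⟨a, ha, rfl⟩)
  have hvec {v} (hv : v ∈ V) (r) : genericVec v r ∈ Subring.closure (s ∪ C '' R₀) :=
    Subring.subset_closure (.inl (.inl ⟨v, hv, r, rfl⟩))
  have hten {t} (ht : t ∈ T) (r u) : genericTensor t r u ∈ Subring.closure (s ∪ C '' R₀) :=
    Subring.subset_closure (.inl (.inr ⟨t, ht, r, u, rfl⟩))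
  have hvt {v} (hv : v ∈ V) {t} (ht : t ∈ T) (r p q) :
      cayleyPolar (genericVec v r) (genericTensor t p q) ∈ Subring.closure (s ∪ C '' R₀) := by
    rw [cayleyPolar_genericVec_genericTensor, neg_mul_eq_neg_mul]
    exact sub_mem (mul_mem (neg_mem (hC (hskew _ _))) (hvec (hTV _ (hT _ ht) _ hv) _))
      (mul_mem (hC (hskew _ _)) (hvec (hTV _ ht _ hv) _))
  have hΩ : ∀ f ∈ s, cayleyOmega f ∈ Subring.closure (s ∪ C '' R₀) := by
    rintro f (⟨v, hv, r, rfl⟩ | ⟨t, ht, r, u, rfl⟩)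
    · rw [cayleyOmega_genericVec]; exact zero_mem _
    · rw [cayleyOmega_genericTensor]
      exact hC (mul_mem (hskew _ _) (htr _ ht))
  have hΓ : ∀ f ∈ s, ∀ h ∈ s, cayleyPolar f h ∈ Subring.closure (s ∪ C '' R₀) := by
    rintro f (⟨v, hv, r, rfl⟩ | ⟨t, ht, r, u, rfl⟩) h (⟨w, hw, p, rfl⟩ | ⟨t', ht', p, q, rfl⟩)
    · rw [cayleyPolar_genericVec_genericVec]
      exact hC (mul_mem (hskew _ _) (hVV _ hv _ hw))
    · exact hvt hv ht' _ _ _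
    · rw [cayleyPolar_comm]; exact hvt hw ht _ _ _
    · rw [cayleyPolar_genericTensor_genericTensor]
      refine add_mem (add_mem (add_mem ?_ ?_) ?_) ?_ <;> refine mul_mem (hC (hskew _ _)) (hten ?_ _ _)
      · exact hTT _ (hT _ ht) _ ht'
      · exact hTT _ (hT _ ht) _ (hT _ ht')
      · exact hTT _ ht _ ht'
      · exact hTT _ ht _ (hT _ ht')
  have hiter (N : ℕ) : cayleyOmega^[N] (e.eval₂ C genericDet) ∈
      Subring.closure (s ∪ C '' R₀) := by
    induction N with
    | zero => exact he
    | succ N ih => rw [Function.iterate_succ_apply']; exact cayleyOmega_mem_closure hΩ hΓ ih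
  rw [← constantCoeff_cayleyOmega_iterate_eval₂]
  refine (Subring.closure_le (t := R₀.comap constantCoeff)).2 ?_ (hiter N)
  rintro _ ((⟨v, -, r, rfl⟩ | ⟨t, -, r, u, rfl⟩) | ⟨a, ha, rfl⟩)
  · simp [genericVec, zero_mem]
  · simp [genericTensor, zero_mem]
  · simpa using ha

end Closure

section Tensors

variable {m n : ℕ}

variable (m n) in
/-- The algebra generated by the transvectants `gen`. -/
def genAlg : Subalgebra ℂ (CoordRing m n) := Algebra.adjoin ℂ (Set.range gen)

theorem C_half_two : (C (1 / 2) : CoordRing m n) * 2 = 1 := by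
  rw [← map_ofNat C, ← C_mul]; norm_num

theorem ofNat_mem_genAlg (k : ℕ) [k.AtLeastTwo] :
    (OfNat.ofNat k : CoordRing m n) ∈ genAlg m n :=
  natCast_mem _ k

theorem linLin_mem (i j : Fin m) : linLin i j ∈ genAlg m n := by
  have key {i j : Fin m} (h : i < j) : linLin i j ∈ genAlg m n :=
    Algebra.subset_adjoin ⟨.inl ⟨(i, j), h⟩, rfl⟩
  rcases lt_trichotomy i j with h | rfl | h
  · exact key h
  · convert zero_mem (genAlg m n); simp only [linLin]; ring
  · convert neg_mem (key h) using 1; simp only [linLin]; ring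

theorem quadQuad_mem (i j : Fin n) : quadQuad i j ∈ genAlg m n := by
  have key {i j : Fin n} (h : i ≤ j) : quadQuad i j ∈ genAlg m n :=
    Algebra.subset_adjoin ⟨.inr (.inl ⟨(i, j), h⟩), rfl⟩
  rcases le_total i j with h | h
  · exact key h
  · convert key h using 1; simp only [quadQuad]; ring

theorem quadLinLin_mem (k : Fin n) (i j : Fin m) : quadLinLin k i j ∈ genAlg m n := by
  have key {i j : Fin m} (h : i ≤ j) : quadLinLin k i j ∈ genAlg m n :=
    Algebra.subset_adjoin ⟨.inr (.inr (.inl (k, ⟨(i, j), h⟩))), rfl⟩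
  rcases le_total i j with h | h
  · exact key h
  · convert key h using 1; simp only [quadLinLin]; ring

theorem quadTriple_swap_left (i j k : Fin n) :
    (quadTriple i j k : CoordRing m n) = -quadTriple j i k := by
  simp only [quadTriple]; ring

theorem quadTriple_swap_right (i j k : Fin n) :
    (quadTriple i j k : CoordRing m n) = -quadTriple i k j := by
  simp only [quadTriple]; ring

theorem quadTriple_mem (i j k : Fin n) : quadTriple i j k ∈ genAlg m n := by
  have sorted {i j k : Fin n} (h : i < j) (h' : j < k) : quadTriple i j k ∈ genAlg m n :=
    Algebra.subset_adjoin ⟨.inr (.inr (.inr (.inl ⟨(i, j, k), h, h'⟩))), rfl⟩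
  have left_eq (i k : Fin n) : quadTriple i i k ∈ genAlg m n := by
    convert zero_mem (genAlg m n); simp only [quadTriple]; ring
  have left_lt {i j : Fin n} (h : i < j) (k : Fin n) : quadTriple i j k ∈ genAlg m n := by
    rcases lt_trichotomy j k with h' | rfl | h'
    · exact sorted h h'
    · convert zero_mem (genAlg m n); simp only [quadTriple]; ring
    · rw [quadTriple_swap_right]
      rcases lt_trichotomy i k with h'' | rfl | h''
      · exact neg_mem (sorted h'' h')
      · exact neg_mem (left_eq _ _)
      · rw [quadTriple_swap_left, neg_neg]; exact sorted h'' h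
  rcases lt_trichotomy i j with h | rfl | h
  · exact left_lt h k
  · exact left_eq i k
  · rw [quadTriple_swap_left]; exact neg_mem (left_lt h k)

theorem quadQuadLinLin_mem (i j : Fin n) (k l : Fin m) :
    quadQuadLinLin i j k l ∈ genAlg m n := by
  have sorted {i j : Fin n} {k l : Fin m} (h : i < j) (h' : k ≤ l) :
      quadQuadLinLin i j k l ∈ genAlg m n :=
    Algebra.subset_adjoin ⟨.inr (.inr (.inr (.inr (⟨(i, j), h⟩, ⟨(k, l), h'⟩)))), rfl⟩
  have left_sorted {i j : Fin n} (h : i < j) : quadQuadLinLin i j k l ∈ genAlg m n := by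
    rcases le_total k l with h' | h'
    · exact sorted h h'
    · convert sorted h h' using 1; simp only [quadQuadLinLin]; ring
  rcases lt_trichotomy i j with h | rfl | h
  · exact left_sorted h
  · convert zero_mem (genAlg m n); simp only [quadQuadLinLin]; ring
  · convert neg_mem (left_sorted h) using 1; simp only [quadQuadLinLin]; ring

/-- The vector `J ℓᵢ`, for the standard skew matrix `J`. -/
def skewVec (i : Fin m) : Fin 2 → CoordRing m n := ![linCoord i 1, -linCoord i 0]

/-- Twice the symmetric Gram matrix of `qⱼ`. -/
def quadMat (j : Fin n) : Matrix (Fin 2) (Fin 2) (CoordRing m n) :=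
  !![2 * quadCoord j 0, quadCoord j 1; quadCoord j 1, 2 * quadCoord j 2]

theorem skew_mul_skew : (skew * skew : Matrix (Fin 2) (Fin 2) (CoordRing m n)) = -1 := by
  ext r s : 1
  fin_cases r <;> fin_cases s <;> simp [skew, Matrix.mul_apply, Fin.sum_univ_two]

theorem two_mul_quadQuad (i j : Fin n) : (2 * quadQuad i j : CoordRing m n) =
    2 * (quadCoord i 0 * quadCoord j 2 + quadCoord i 2 * quadCoord j 0) -
      quadCoord i 1 * quadCoord j 1 := by
  rw [quadQuad]
  linear_combination -(quadCoord i 1 * quadCoord j 1) * C_half_two (m := m) (n := n)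

theorem two_mul_quadTriple (i j k : Fin n) : (2 * quadTriple i j k : CoordRing m n) =
    quadCoord i 0 * (quadCoord j 1 * quadCoord k 2 - quadCoord j 2 * quadCoord k 1) +
      quadCoord i 2 * (quadCoord j 0 * quadCoord k 1 - quadCoord j 1 * quadCoord k 0) -
      quadCoord i 1 * (quadCoord j 0 * quadCoord k 2 - quadCoord j 2 * quadCoord k 0) := by
  rw [quadTriple]
  linear_combination
    (quadCoord i 0 * (quadCoord j 1 * quadCoord k 2 - quadCoord j 2 * quadCoord k 1) +
      quadCoord i 2 * (quadCoord j 0 * quadCoord k 1 - quadCoord j 1 * quadCoord k 0) -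
      quadCoord i 1 * (quadCoord j 0 * quadCoord k 2 - quadCoord j 2 * quadCoord k 0)) *
      C_half_two (m := m) (n := n)

theorem quadMat_triple (i j k : Fin n) :
    (quadMat i * skew * (quadMat j * skew * quadMat k) :
      Matrix (Fin 2) (Fin 2) (CoordRing m n)) =
      (2 * (2 * quadTriple i j k) : CoordRing m n) • skew +
        (-(2 * quadQuad j k) : CoordRing m n) • quadMat i +
        (2 * quadQuad i k : CoordRing m n) • quadMat j +
        (-(2 * quadQuad i j) : CoordRing m n) • quadMat k := by
  rw [two_mul_quadTriple, two_mul_quadQuad, two_mul_quadQuad, two_mul_quadQuad]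
  ext r s : 1
  fin_cases r <;> fin_cases s <;>
    simp [quadMat, skew, Matrix.mul_apply, Fin.sum_univ_two] <;> ring

variable (m n) in
/-- The basic tensors `J`, `Sᵢ` and `Sᵢ J Sⱼ`. -/
def baseTensors : Set (Matrix (Fin 2) (Fin 2) (CoordRing m n)) :=
  {t | t = skew ∨ (∃ i, t = quadMat i) ∨ ∃ i j, t = quadMat i * skew * quadMat j}

variable (m n) in
/-- The module of tensors spanned by the basic ones over the algebra `genAlg`. -/
def tensors : Submodule (genAlg m n) (Matrix (Fin 2) (Fin 2) (CoordRing m n)) :=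
  Submodule.span (genAlg m n) (baseTensors m n)

theorem smul_mem_tensors {a : CoordRing m n} (ha : a ∈ genAlg m n)
    {t : Matrix (Fin 2) (Fin 2) (CoordRing m n)} (ht : t ∈ tensors m n) : a • t ∈ tensors m n :=
  (tensors m n).smul_mem ⟨a, ha⟩ ht

theorem skew_mem_tensors : skew ∈ tensors m n := Submodule.subset_span (.inl rfl)

theorem quadMat_mem_tensors (i : Fin n) : quadMat i ∈ tensors m n :=
  Submodule.subset_span (.inr (.inl ⟨i, rfl⟩))

theorem quadMat_mul_mem_tensors (i j : Fin n) : quadMat i * skew * quadMat j ∈ tensors m n :=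
  Submodule.subset_span (.inr (.inr ⟨i, j, rfl⟩))

@[elab_as_elim]
theorem tensors_induction {motive : ∀ t, t ∈ tensors m n → Prop}
    (skew : motive skew skew_mem_tensors) (quad : ∀ i, motive (quadMat i) (quadMat_mem_tensors i))
    (mul : ∀ i j, motive (quadMat i * BinInv.skew * quadMat j) (quadMat_mul_mem_tensors i j))
    (zero : motive 0 (zero_mem _))
    (add : ∀ t u ht hu, motive t ht → motive u hu → motive (t + u) (add_mem ht hu))
    (smul : ∀ (a) (ha : a ∈ genAlg m n) (t ht), motive t ht →
      motive (a • t) (smul_mem_tensors ha ht))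
    {t : Matrix (Fin 2) (Fin 2) (CoordRing m n)} (ht : t ∈ tensors m n) : motive t ht := by
  induction ht using Submodule.span_induction with
  | mem t h =>
    rcases h with rfl | ⟨i, rfl⟩ | ⟨i, j, rfl⟩
    exacts [skew, quad i, mul i j]
  | zero => exact zero
  | add t u _ _ ht hu => exact add t u _ _ ht hu
  | smul a t _ ht => exact smul a a.2 t _ ht

theorem quadMat_mul_skew_mul_mem (i : Fin n) {t : Matrix (Fin 2) (Fin 2) (CoordRing m n)}
    (ht : t ∈ tensors m n) : quadMat i * skew * t ∈ tensors m n := by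
  induction ht using tensors_induction with
  | skew =>
    rw [mul_assoc, skew_mul_skew, mul_neg, mul_one]
    exact neg_mem (quadMat_mem_tensors i)
  | quad j => exact quadMat_mul_mem_tensors i j
  | mul j k =>
    rw [quadMat_triple]
    have two : (2 : CoordRing m n) ∈ genAlg m n := ofNat_mem_genAlg 2
    refine add_mem (add_mem (add_mem ?_ ?_) ?_) ?_
    · exact smul_mem_tensors (mul_mem two (mul_mem two (quadTriple_mem i j k))) skew_mem_tensors
    · exact smul_mem_tensors (neg_mem (mul_mem two (quadQuad_mem j k))) (quadMat_mem_tensors _)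
    · exact smul_mem_tensors (mul_mem two (quadQuad_mem i k)) (quadMat_mem_tensors _)
    · exact smul_mem_tensors (neg_mem (mul_mem two (quadQuad_mem i j))) (quadMat_mem_tensors _)
  | zero => rw [mul_zero]; exact zero_mem _
  | add t u _ _ ht hu => rw [mul_add]; exact add_mem ht hu
  | smul a ha t _ ht => rw [mul_smul_comm]; exact smul_mem_tensors ha ht

theorem mul_skew_mul_mem_tensors {t u : Matrix (Fin 2) (Fin 2) (CoordRing m n)}
    (ht : t ∈ tensors m n) (hu : u ∈ tensors m n) : t * skew * u ∈ tensors m n := by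
  induction ht using tensors_induction with
  | skew => rw [skew_mul_skew, neg_mul, one_mul]; exact neg_mem hu
  | quad i => exact quadMat_mul_skew_mul_mem i hu
  | mul i j =>
    rw [mul_assoc _ skew u, mul_assoc _ (quadMat j), ← mul_assoc (quadMat j)]
    exact quadMat_mul_skew_mul_mem i (quadMat_mul_skew_mul_mem j hu)
  | zero => rw [zero_mul, zero_mul]; exact zero_mem _
  | add t t' _ _ ht ht' => rw [add_mul, add_mul]; exact add_mem ht ht'
  | smul a ha t _ ht => rw [smul_mul_assoc, smul_mul_assoc]; exact smul_mem_tensors ha ht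

theorem transpose_mem_tensors {t : Matrix (Fin 2) (Fin 2) (CoordRing m n)}
    (ht : t ∈ tensors m n) : t.transpose ∈ tensors m n := by
  have hJ : (skew : Matrix (Fin 2) (Fin 2) (CoordRing m n)).transpose = -skew := by
    ext r s : 1; fin_cases r <;> fin_cases s <;> simp [skew]
  have hS (i : Fin n) : (quadMat i : Matrix (Fin 2) (Fin 2) (CoordRing m n)).transpose =
      quadMat i := by
    ext r s : 1; fin_cases r <;> fin_cases s <;> simp [quadMat]
  induction ht using tensors_induction with
  | skew => rw [hJ]; exact neg_mem skew_mem_tensors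
  | quad i => rw [hS]; exact quadMat_mem_tensors i
  | mul i j =>
    rw [Matrix.transpose_mul, Matrix.transpose_mul, hJ, hS, hS, neg_mul, mul_neg, ← mul_assoc]
    exact neg_mem (quadMat_mul_mem_tensors j i)
  | zero => rw [Matrix.transpose_zero]; exact zero_mem _
  | add t u _ _ ht hu => rw [Matrix.transpose_add]; exact add_mem ht hu
  | smul a ha t _ ht => rw [Matrix.transpose_smul]; exact smul_mem_tensors ha ht

theorem skew_part_mem {t : Matrix (Fin 2) (Fin 2) (CoordRing m n)}
    (ht : t ∈ tensors m n) : t 0 1 - t 1 0 ∈ genAlg m n := by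
  have four : (4 : CoordRing m n) ∈ genAlg m n := ofNat_mem_genAlg 4
  induction ht using tensors_induction with
  | skew => simpa [skew] using add_mem (one_mem (genAlg m n)) (one_mem _)
  | quad i => simp [quadMat, zero_mem]
  | mul i j =>
    convert mul_mem four (quadQuad_mem i j) using 1
    simp [quadMat, skew, Matrix.mul_apply, Fin.sum_univ_two]
    linear_combination -2 * two_mul_quadQuad (m := m) i j
  | zero => simp [zero_mem]
  | add t u _ _ ht hu => convert add_mem ht hu using 1; simp only [Matrix.add_apply]; ring
  | smul a ha t _ ht =>
    convert mul_mem ha ht using 1; simp only [Matrix.smul_apply, smul_eq_mul]; ring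

theorem skewVec_dotProduct_mem {t : Matrix (Fin 2) (Fin 2) (CoordRing m n)}
    (ht : t ∈ tensors m n) (i j : Fin m) :
    dotProduct (skewVec i) (t.mulVec (skewVec j)) ∈ genAlg m n := by
  have two : (2 : CoordRing m n) ∈ genAlg m n := ofNat_mem_genAlg 2
  have four : (4 : CoordRing m n) ∈ genAlg m n := ofNat_mem_genAlg 4
  have h := C_half_two (m := m) (n := n)
  induction ht using tensors_induction with
  | skew =>
    convert linLin_mem i j using 1
    simp [skew, skewVec, Matrix.mulVec, dotProduct, Fin.sum_univ_two, linLin]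
    ring
  | quad k =>
    convert mul_mem two (quadLinLin_mem k i j) using 1
    simp [quadMat, skewVec, Matrix.mulVec, dotProduct, Fin.sum_univ_two, quadLinLin, -one_div]
    linear_combination quadCoord k 1 *
      (linCoord i 0 * linCoord j 1 + linCoord i 1 * linCoord j 0) * h
  | mul a b =>
    convert add_mem (mul_mem four (quadQuadLinLin_mem a b i j))
      (mul_mem two (mul_mem (quadQuad_mem a b) (linLin_mem i j))) using 1
    simp [quadMat, skew, skewVec, Matrix.mulVec, dotProduct, Matrix.mul_apply, Fin.sum_univ_two,
      quadQuadLinLin, linLin, -one_div]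
    linear_combination (-2 * ((quadCoord a 0 * quadCoord b 1 - quadCoord a 1 * quadCoord b 0) *
      (linCoord i 1 * linCoord j 1) +
      (quadCoord a 1 * quadCoord b 2 - quadCoord a 2 * quadCoord b 1) *
      (linCoord i 0 * linCoord j 0) -
      (quadCoord a 0 * quadCoord b 2 - quadCoord a 2 * quadCoord b 0) *
      (linCoord i 0 * linCoord j 1 + linCoord i 1 * linCoord j 0))) * h -
      (linCoord i 0 * linCoord j 1 - linCoord i 1 * linCoord j 0) *
        two_mul_quadQuad (m := m) a b
  | zero => simp [zero_mem]
  | add t u _ _ ht hu => rw [Matrix.add_mulVec, dotProduct_add]; exact add_mem ht hu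
  | smul a ha t _ ht => rw [Matrix.smul_mulVec, dotProduct_smul]; exact mul_mem ha ht

end Tensors

section FirstFundamentalTheorem

variable {m n : ℕ}

variable (m n) in
/-- The vectors obtained by applying tensors to the vectors `J ℓᵢ`. -/
def vectors : Set (Fin 2 → CoordRing m n) := {v | ∃ t ∈ tensors m n, ∃ i, v = t.mulVec (skewVec i)}

variable (m n) in
/-- The ring generated by the coordinates of the generic transforms of all tensors and vectors,
and by the constants in `genAlg`. -/
def genericRing : Subring (MvPolynomial (Fin 2 × Fin 2) (CoordRing m n)) :=
  Subring.closure (({f | ∃ v ∈ vectors m n, ∃ r, f = genericVec v r} ∪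
    {f | ∃ t ∈ (tensors m n : Set (Matrix (Fin 2) (Fin 2) (CoordRing m n))), ∃ r s,
      f = genericTensor t r s}) ∪ C '' (genAlg m n).toSubring)

theorem coeff_mem_genAlg {e : Polynomial (CoordRing m n)}
    (he : e.eval₂ C genericDet ∈ genericRing m n) (N : ℕ) : e.coeff N ∈ genAlg m n := by
  have key := factorial_mul_coeff_mem (genAlg m n).toSubring (vectors m n) (tensors m n)
    ?_ ?_ (fun t ht => transpose_mem_tensors ht) (fun t ht u hu => mul_skew_mul_mem_tensors ht hu)
    (fun t ht => skew_part_mem ht) he N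
  · have hk : (N.factorial * (N + 1).factorial : ℕ) ≠ 0 := by positivity
    generalize N.factorial * (N + 1).factorial = k at key hk
    have h := (genAlg m n).smul_mem key (k : ℂ)⁻¹
    rwa [← nsmul_eq_mul, ← Nat.cast_smul_eq_nsmul ℂ, inv_smul_smul₀ (Nat.cast_ne_zero.2 hk)] at h
  · rintro _ ⟨t, ht, i, rfl⟩ _ ⟨u, hu, j, rfl⟩
    have h := skewVec_dotProduct_mem
      (mul_skew_mul_mem_tensors (transpose_mem_tensors ht) hu) i j
    convert h using 1
    simp [Matrix.mulVec, dotProduct, Matrix.mul_apply, Fin.sum_univ_two, skew]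
    ring_nf
  · rintro t ht _ ⟨u, hu, j, rfl⟩
    exact ⟨t * skew * u, mul_skew_mul_mem_tensors ht hu, j, by
      rw [Matrix.mulVec_mulVec, Matrix.mulVec_mulVec, mul_assoc]⟩

theorem linVec_mem_vectors (i : Fin m) : ![linCoord i 0, linCoord i 1] ∈ vectors m n := by
  refine ⟨-skew, neg_mem skew_mem_tensors, i, ?_⟩
  funext r
  fin_cases r <;> simp [skew, skewVec, Matrix.mulVec, dotProduct, Fin.sum_univ_two]

variable (m n) in
/-- The generic substitution of variables on polynomial functions. -/
def genericSubst : CoordRing m n →ₐ[ℂ] MvPolynomial (Fin 2 × Fin 2) (CoordRing m n) :=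
  aeval (idxElim (fun i r => genericVec ![linCoord i 0, linCoord i 1] r)
    (fun j => ![C (C (1 / 2)) * genericTensor (quadMat j) 0 0, genericTensor (quadMat j) 0 1,
      C (C (1 / 2)) * genericTensor (quadMat j) 1 1]))

theorem genericSubst_mem (P : CoordRing m n) : genericSubst m n P ∈ genericRing m n := by
  have hC (a : ℂ) : C (C a) ∈ genericRing m n :=
    Subring.subset_closure (.inr ⟨C a, (genAlg m n).algebraMap_mem a, rfl⟩)
  have hT (j : Fin n) (r s) : genericTensor (quadMat j) r s ∈ genericRing m n :=
    Subring.subset_closure (.inl (.inr ⟨_, quadMat_mem_tensors j, r, s, rfl⟩))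
  induction P using MvPolynomial.induction_on with
  | C a => rw [genericSubst, aeval_C]; exact hC a
  | add p q hp hq => rw [map_add]; exact add_mem hp hq
  | mul_X p a hp =>
    rw [map_mul]
    refine mul_mem hp ?_
    rw [genericSubst, aeval_X]
    induction a using idx_cases with
    | lin i r =>
      rw [idxElim_linIdx]
      exact Subring.subset_closure (.inl (.inl ⟨_, linVec_mem_vectors i, r, rfl⟩))
    | quad j r =>
      rw [idxElim_quadIdx]
      fin_cases r
      exacts [mul_mem (hC _) (hT _ _ _), hT _ _ _, mul_mem (hC _) (hT _ _ _)]

theorem eval₂_genericSubst (c : Idx (mixedDeg m n) → ℂ) (G : Matrix (Fin 2) (Fin 2) ℂ)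
    (P : CoordRing m n) :
    eval₂ (eval c) (fun p => G p.1 p.2) (genericSubst m n P) = eval (substPt G c) P := by
  induction P using MvPolynomial.induction_on with
  | C a => rw [genericSubst, aeval_C]; exact (eval₂_C _ _ _).trans (by simp)
  | add p q hp hq => rw [map_add, map_add, eval₂_add, hp, hq]
  | mul_X p a hp =>
    rw [map_mul, map_mul, eval₂_mul, hp, genericSubst, aeval_X, eval_X]
    congr 1
    induction a using idx_cases with
    | lin i r => simp [substPt, genericVec, linCoord]
    | quad j r =>
      fin_cases r <;> simp [substPt, genericTensor, quadMat, quadCoord] <;> ring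

theorem substPt_mul (G H : Matrix (Fin 2) (Fin 2) ℂ) (c : Idx (mixedDeg m n) → ℂ) :
    substPt (G * H) c = substPt G (substPt H c) := by
  funext a
  induction a using idx_cases with
  | lin i r => simp [substPt, Matrix.mul_apply, Fin.sum_univ_two]; ring
  | quad j r =>
    fin_cases r <;> simp [substPt, Matrix.mul_apply, Fin.sum_univ_two] <;> ring

theorem eval_substPt_of_det_eq_one {P : CoordRing m n} (hP : P ∈ invariantRing (mixedDeg m n))
    {G : Matrix (Fin 2) (Fin 2) ℂ} (hG : G.det = 1) (c : Idx (mixedDeg m n) → ℂ) :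
    eval (substPt G c) P = eval c P := by
  obtain ⟨g, hg⟩ : ∃ g : Matrix.SpecialLinearGroup (Fin 2) ℂ, (g : Matrix _ _ ℂ) = G.transpose :=
    ⟨⟨G.transpose, by rwa [Matrix.det_transpose]⟩, rfl⟩
  have h := hP g⁻¹ c
  rwa [actPt_eq_substPt, inv_inv, hg, Matrix.transpose_transpose] at h

variable (m n) in
/-- The scaling of polynomial functions which multiplies linear coefficients by `T` and quadratic
ones by `T²`. -/
def scaling : CoordRing m n →ₐ[ℂ] Polynomial (CoordRing m n) :=
  aeval (idxElim (fun i r => Polynomial.X * Polynomial.C (linCoord i r))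
    (fun j r => Polynomial.X ^ 2 * Polynomial.C (quadCoord j r)))

theorem eval₂_scaling (c : Idx (mixedDeg m n) → ℂ) (δ : ℂ) (P : CoordRing m n) :
    (scaling m n P).eval₂ (eval c) δ = eval (substPt (δ • 1) c) P := by
  induction P using MvPolynomial.induction_on with
  | C a => rw [scaling, aeval_C]; exact (Polynomial.eval₂_C _ _).trans (by simp)
  | add p q hp hq => rw [map_add, map_add, Polynomial.eval₂_add, hp, hq]
  | mul_X p a hp =>
    rw [map_mul, map_mul, Polynomial.eval₂_mul, hp, scaling, aeval_X, eval_X]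
    congr 1
    induction a using idx_cases with
    | lin i r =>
      fin_cases r <;> simp [substPt, linCoord] <;> ring
    | quad j r =>
      fin_cases r <;> simp [substPt, quadCoord, pow_two]

theorem eval_one_scaling (P : CoordRing m n) : (scaling m n P).eval 1 = P := by
  induction P using MvPolynomial.induction_on with
  | C a => rw [scaling, aeval_C]; exact Polynomial.eval_C
  | add p q hp hq => rw [map_add, Polynomial.eval_add, hp, hq]
  | mul_X p a hp =>
    rw [map_mul, Polynomial.eval_mul, hp, scaling, aeval_X]
    congr 1
    induction a using idx_cases with
    | lin i r => simp [linCoord]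
    | quad j r => simp [quadCoord]

theorem coeff_scaling_of_odd {P : CoordRing m n} (hP : P ∈ invariantRing (mixedDeg m n)) {N : ℕ}
    (hN : Odd N) : (scaling m n P).coeff N = 0 := by
  refine MvPolynomial.funext fun c => ?_
  have h : ((scaling m n P).map (eval c)).comp (Polynomial.C (-1) * Polynomial.X) = (scaling m n P).map (eval c) := by
    refine Polynomial.funext fun δ => ?_
    rw [Polynomial.eval_comp, Polynomial.eval_mul, Polynomial.eval_X, Polynomial.eval_C,
      neg_one_mul, Polynomial.eval_map,
      Polynomial.eval_map, eval₂_scaling, eval₂_scaling,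
      show (-δ) • (1 : Matrix (Fin 2) (Fin 2) ℂ) = -1 * (δ • 1) by simp, substPt_mul]
    exact eval_substPt_of_det_eq_one hP (by simp [Matrix.det_fin_two]) _
  have h' := congrArg (fun q => q.coeff N) h
  simp only [Polynomial.comp_C_mul_X_coeff, hN.neg_one_pow, Polynomial.coeff_map] at h'
  rw [map_zero]
  linear_combination (-1 / 2) * h'

theorem eq_zero_of_eval₂_eq_zero {σ τ : Type*} {f : MvPolynomial σ (MvPolynomial τ ℂ)}
    (hf : ∀ c x, eval₂ (eval c) x f = 0) : f = 0 := by
  ext1 d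
  refine MvPolynomial.funext fun c => ?_
  have h : map (eval c) f = 0 := MvPolynomial.funext fun x => by
    rw [eval_map, hf, map_zero]
  rw [← coeff_map, h, coeff_zero, coeff_zero, map_zero]

theorem genericSubst_eq_eval₂ {P : CoordRing m n} (hP : P ∈ invariantRing (mixedDeg m n)) :
    genericSubst m n P = ((scaling m n P).contract 2).eval₂ C genericDet := by
  have hexp : Polynomial.expand _ 2 ((scaling m n P).contract 2) = scaling m n P := by
    ext1 N
    rw [Polynomial.coeff_expand two_pos]
    split_ifs with h
    · rw [Polynomial.coeff_contract two_ne_zero, Nat.div_mul_cancel h]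
    · rw [coeff_scaling_of_odd hP (Nat.not_even_iff_odd.1 fun h' => h h'.two_dvd)]
  have hdet : (genericDet : MvPolynomial (Fin 2 × Fin 2) (CoordRing m n)) ≠ 0 := by
    intro h
    have := congrArg (eval fun p => if p.1 = p.2 then 1 else 0) h
    simp [genericDet] at this
  rw [← sub_eq_zero]
  refine (mul_eq_zero.1 (eq_zero_of_eval₂_eq_zero fun c x => ?_)).resolve_left hdet
  set G : Matrix (Fin 2) (Fin 2) ℂ := Matrix.of fun r s => x (r, s) with hG
  have hx : x = fun p => G p.1 p.2 := rfl
  have hGdet : eval₂ (eval c) x genericDet = G.det := by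
    simp [genericDet, Matrix.det_fin_two, hG]
  rw [eval₂_mul, hGdet]
  by_cases h0 : G.det = 0
  · rw [h0, zero_mul]
  obtain ⟨δ, hδ⟩ := IsAlgClosed.exists_pow_nat_eq G.det two_pos
  have hδ0 : δ ≠ 0 := by rintro rfl; exact h0 (by rw [← hδ]; simp)
  have hGδ : G = (δ⁻¹ • G) * (δ • 1) := by
    rw [Matrix.mul_smul, mul_one, smul_smul, mul_inv_cancel₀ hδ0, one_smul]
  have hlhs : eval₂ (eval c) x (genericSubst m n P) = eval (substPt (δ • 1) c) P := by
    rw [hx, eval₂_genericSubst]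
    conv_lhs => rw [hGδ]
    rw [substPt_mul, eval_substPt_of_det_eq_one hP]
    rw [Matrix.det_smul, Fintype.card_fin, ← hδ, ← mul_pow, inv_mul_cancel₀ hδ0, one_pow]
  have hrhs : eval₂ (eval c) x (((scaling m n P).contract 2).eval₂ C genericDet) =
      eval (substPt (δ • 1) c) P := by
    have h : (scaling m n P).eval₂ (eval c) δ =
        ((scaling m n P).contract 2).eval₂ (eval c) (δ ^ 2) := by
      conv_lhs => rw [← hexp]
      rw [← Polynomial.eval_map, Polynomial.map_expand, Polynomial.expand_eval,
        Polynomial.eval_map]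
    rw [← eval₂_scaling, h, hδ, ← hGdet]
    have := Polynomial.hom_eval₂ ((scaling m n P).contract 2) C (eval₂Hom (eval c) x) genericDet
    rw [coe_eval₂Hom] at this
    rw [this]
    congr 1
    ext a <;> simp
  rw [eval₂_sub, hlhs, hrhs, sub_self, mul_zero]

theorem genAlg_eq_invariantRing : genAlg m n = invariantRing (mixedDeg m n) := by
  refine le_antisymm (Algebra.adjoin_le ?_) fun P hP => ?_
  · rintro _ ⟨α, rfl⟩
    exact gen_mem_invariantRing α
  · have hmem (N : ℕ) : (scaling m n P).coeff N ∈ genAlg m n := by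
      rcases Nat.even_or_odd' N with ⟨k, rfl | rfl⟩
      · rw [mul_comm, ← Polynomial.coeff_contract two_ne_zero]
        refine coeff_mem_genAlg ?_ k
        rw [← genericSubst_eq_eval₂ hP]
        exact genericSubst_mem P
      · rw [coeff_scaling_of_odd hP (odd_two_mul_add_one k)]
        exact zero_mem _
    rw [← eval_one_scaling P, Polynomial.eval_eq_sum]
    refine sum_mem fun N _ => ?_
    simp only [one_pow, mul_one]
    exact hmem N

end FirstFundamentalTheorem

section Expansion

variable {m n : ℕ}

/-- The exponent vector of the monomial that is the product of the given variables. -/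
def expo (L : List (Idx (mixedDeg m n))) : Idx (mixedDeg m n) →₀ ℕ :=
  (L.map fun a => Finsupp.single a 1).sum

theorem monomial_expo (L : List (Idx (mixedDeg m n))) (c : ℂ) :
    monomial (expo L) c = C c * (L.map X).prod := by
  induction L with
  | nil => simp [expo]
  | cons a L ih =>
    rw [List.map_cons, List.prod_cons, mul_left_comm, ← ih, X, monomial_mul, one_mul]
    simp [expo]

theorem expo_apply (L : List (Idx (mixedDeg m n))) (a : Idx (mixedDeg m n)) :
    expo L a = L.countP (· = a) := by
  induction L with
  | nil => simp [expo]
  | cons b L ih =>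
    have : expo (b :: L) a = Finsupp.single b 1 a + expo L a := by simp [expo]
    rw [this, ih, List.countP_cons, Finsupp.single_apply, add_comm]
    simp

theorem expo_ne {L L' : List (Idx (mixedDeg m n))} (a : Idx (mixedDeg m n))
    (h : L.countP (· = a) ≠ L'.countP (· = a)) : expo L ≠ expo L' := fun e =>
  h (by rw [← expo_apply, ← expo_apply, e])

theorem linLin_expand (i j : Fin m) : (linLin i j : CoordRing m n) =
    monomial (expo [linIdx i 0, linIdx j 1]) 1 - monomial (expo [linIdx i 1, linIdx j 0]) 1 := by
  simp only [monomial_expo, linLin, linCoord, List.map_cons, List.map_nil, List.prod_cons,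
    List.prod_nil, C_1]
  ring

theorem quadQuad_expand (i j : Fin n) : (quadQuad i j : CoordRing m n) =
    monomial (expo [quadIdx i 0, quadIdx j 2]) 1 + monomial (expo [quadIdx i 2, quadIdx j 0]) 1 -
      monomial (expo [quadIdx i 1, quadIdx j 1]) (1 / 2) := by
  simp only [monomial_expo, quadQuad, quadCoord, List.map_cons, List.map_nil, List.prod_cons,
    List.prod_nil, C_1]
  ring

theorem quadLinLin_expand (k : Fin n) (i j : Fin m) : (quadLinLin k i j : CoordRing m n) =
    monomial (expo [quadIdx k 0, linIdx i 1, linIdx j 1]) 1 +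
      monomial (expo [quadIdx k 2, linIdx i 0, linIdx j 0]) 1 -
      monomial (expo [quadIdx k 1, linIdx i 0, linIdx j 1]) (1 / 2) -
      monomial (expo [quadIdx k 1, linIdx i 1, linIdx j 0]) (1 / 2) := by
  simp only [monomial_expo, quadLinLin, quadCoord, linCoord, List.map_cons, List.map_nil,
    List.prod_cons, List.prod_nil, C_1]
  ring

theorem quadTriple_expand (i j k : Fin n) : (quadTriple i j k : CoordRing m n) =
    monomial (expo [quadIdx i 0, quadIdx j 1, quadIdx k 2]) (1 / 2) -
      monomial (expo [quadIdx i 0, quadIdx j 2, quadIdx k 1]) (1 / 2) +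
      monomial (expo [quadIdx i 2, quadIdx j 0, quadIdx k 1]) (1 / 2) -
      monomial (expo [quadIdx i 2, quadIdx j 1, quadIdx k 0]) (1 / 2) -
      monomial (expo [quadIdx i 1, quadIdx j 0, quadIdx k 2]) (1 / 2) +
      monomial (expo [quadIdx i 1, quadIdx j 2, quadIdx k 0]) (1 / 2) := by
  simp only [monomial_expo, quadTriple, quadCoord, List.map_cons, List.map_nil,
    List.prod_cons, List.prod_nil]
  ring

theorem quadQuadLinLin_expand (i j : Fin n) (k l : Fin m) :
    (quadQuadLinLin i j k l : CoordRing m n) =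
    monomial (expo [quadIdx i 0, quadIdx j 1, linIdx k 1, linIdx l 1]) (1 / 2) -
      monomial (expo [quadIdx i 1, quadIdx j 0, linIdx k 1, linIdx l 1]) (1 / 2) +
      monomial (expo [quadIdx i 1, quadIdx j 2, linIdx k 0, linIdx l 0]) (1 / 2) -
      monomial (expo [quadIdx i 2, quadIdx j 1, linIdx k 0, linIdx l 0]) (1 / 2) -
      monomial (expo [quadIdx i 0, quadIdx j 2, linIdx k 0, linIdx l 1]) (1 / 2) -
      monomial (expo [quadIdx i 0, quadIdx j 2, linIdx k 1, linIdx l 0]) (1 / 2) +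
      monomial (expo [quadIdx i 2, quadIdx j 0, linIdx k 0, linIdx l 1]) (1 / 2) +
      monomial (expo [quadIdx i 2, quadIdx j 0, linIdx k 1, linIdx l 0]) (1 / 2) := by
  simp only [monomial_expo, quadQuadLinLin, quadCoord, linCoord, List.map_cons, List.map_nil,
    List.prod_cons, List.prod_nil]
  ring

/-- The exponent vector of a distinguished monomial of each generator. -/
def leadExpo : GenIdx m n → Idx (mixedDeg m n) →₀ ℕ
  | .inl p => expo [linIdx p.1.1 0, linIdx p.1.2 1]
  | .inr (.inl p) => expo [quadIdx p.1.1 0, quadIdx p.1.2 2]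
  | .inr (.inr (.inl p)) => expo [quadIdx p.1 0, linIdx p.2.1.1 1, linIdx p.2.1.2 1]
  | .inr (.inr (.inr (.inl p))) => expo [quadIdx p.1.1 0, quadIdx p.1.2.1 1, quadIdx p.1.2.2 2]
  | .inr (.inr (.inr (.inr p))) =>
    expo [quadIdx p.1.1.1 0, quadIdx p.1.1.2 1, linIdx p.2.1.1 1, linIdx p.2.1.2 1]

theorem coeff_leadExpo_gen_ne_zero (α : GenIdx m n) : coeff (leadExpo α) (gen α) ≠ 0 := by
  rcases α with ⟨⟨i, j⟩, h⟩ | ⟨⟨i, j⟩, h⟩ | ⟨k, ⟨i, j⟩, h⟩ | ⟨⟨i, j, k⟩, h, h'⟩ |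
      ⟨⟨⟨i, j⟩, h⟩, ⟨k, l⟩, h'⟩
  · simp only at h
    simp only [gen, leadExpo, linLin_expand, coeff_sub, coeff_monomial]
    rw [if_pos trivial, if_neg (expo_ne (linIdx i 0) _)]
    · simp
    · simp [linIdx_inj, h.ne']
  · simp only [gen, leadExpo, quadQuad_expand, coeff_sub, coeff_add, coeff_monomial]
    have h₁ : expo [quadIdx i 1, quadIdx j 1] ≠ expo [quadIdx i 0, quadIdx j 2] :=
      expo_ne (m := m) (quadIdx i 0) (by simp [quadIdx_inj])
    rw [if_pos trivial, if_neg h₁]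
    split_ifs <;> norm_num
  · simp only [gen, leadExpo, quadLinLin_expand, coeff_sub, coeff_add, coeff_monomial]
    rw [if_pos trivial, if_neg (expo_ne (quadIdx k 0) _), if_neg (expo_ne (quadIdx k 0) _),
      if_neg (expo_ne (quadIdx k 0) _)]
    · simp
    all_goals simp [quadIdx_inj, linIdx_ne_quadIdx]
  · simp only at h h'
    have h'' := h.trans h'
    simp only [gen, leadExpo, quadTriple_expand, coeff_sub, coeff_add, coeff_monomial]
    rw [if_pos trivial, if_neg (expo_ne (quadIdx j 1) _), if_neg (expo_ne (quadIdx i 0) _),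
      if_neg (expo_ne (quadIdx i 0) _), if_neg (expo_ne (quadIdx i 0) _),
      if_neg (expo_ne (quadIdx i 0) _)]
    · simp
    all_goals simp [quadIdx_inj, h.ne, h.ne', h'.ne', h''.ne']
  · simp only at h h'
    simp only [gen, leadExpo, quadQuadLinLin_expand, coeff_sub, coeff_add, coeff_monomial]
    rw [if_pos trivial, if_neg (expo_ne (quadIdx i 0) _), if_neg (expo_ne (quadIdx i 0) _),
      if_neg (expo_ne (quadIdx i 0) _), if_neg (expo_ne (quadIdx j 1) _),
      if_neg (expo_ne (quadIdx j 1) _), if_neg (expo_ne (quadIdx i 0) _),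
      if_neg (expo_ne (quadIdx i 0) _)]
    · simp
    all_goals simp [quadIdx_inj, linIdx_ne_quadIdx, h.ne, h.ne']

end Expansion

section Weights

variable {m n : ℕ}

/-- The multidegree of a coordinate function in `ℓ₁, …, ℓₘ` and in `q₁, …, qₙ`, together with
its weight under the diagonal torus of `SL(2,ℂ)`. -/
def coordWt : Idx (mixedDeg m n) → (Multiset (Fin m) × Multiset (Fin n)) × ℤ :=
  idxElim (fun i k => (({i}, 0), ![1, -1] k)) (fun j k => ((0, {j}), ![2, 0, -2] k))

/-- The forms `ℓ` and `q` occurring in a generator, with multiplicity, in increasing order. -/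
def genForms : GenIdx m n → List (Fin m) × List (Fin n)
  | .inl p => ([p.1.1, p.1.2], [])
  | .inr (.inl p) => ([], [p.1.1, p.1.2])
  | .inr (.inr (.inl p)) => ([p.2.1.1, p.2.1.2], [p.1])
  | .inr (.inr (.inr (.inl p))) => ([], [p.1.1, p.1.2.1, p.1.2.2])
  | .inr (.inr (.inr (.inr p))) => ([p.2.1.1, p.2.1.2], [p.1.1.1, p.1.1.2])

/-- The weight of a generator with respect to `coordWt`. -/
def genWt (α : GenIdx m n) : (Multiset (Fin m) × Multiset (Fin n)) × ℤ :=
  ((↑(genForms α).1, ↑(genForms α).2), 0)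

theorem genForms_injective : Function.Injective (genForms : GenIdx m n → _) := by
  intro α β e
  rcases α with ⟨⟨i, j⟩, h⟩ | ⟨⟨i, j⟩, h⟩ | ⟨k, ⟨i, j⟩, h⟩ | ⟨⟨i, j, k⟩, h⟩ |
      ⟨⟨⟨i, j⟩, h⟩, ⟨k, l⟩, h'⟩ <;>
    rcases β with ⟨⟨i₁, j₁⟩, h₁⟩ | ⟨⟨i₁, j₁⟩, h₁⟩ | ⟨k₁, ⟨i₁, j₁⟩, h₁⟩ | ⟨⟨i₁, j₁, k₁⟩, h₁⟩ |
      ⟨⟨⟨i₁, j₁⟩, h₁⟩, ⟨k₁, l₁⟩, h₁'⟩ <;>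
    simp only [genForms, Prod.mk.injEq, List.cons.injEq, reduceCtorEq, and_true, and_false,
      false_and, true_and] at e
  · obtain ⟨rfl, rfl⟩ := e; rfl
  · obtain ⟨rfl, rfl⟩ := e; rfl
  · obtain ⟨⟨rfl, rfl⟩, rfl⟩ := e; rfl
  · obtain ⟨rfl, rfl, rfl⟩ := e; rfl
  · obtain ⟨⟨rfl, rfl⟩, rfl, rfl⟩ := e; rfl

theorem genWt_injective : Function.Injective (genWt : GenIdx m n → _) := by
  have hs : ∀ α : GenIdx m n, (genForms α).1.SortedLE ∧ (genForms α).2.SortedLE := by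
    rintro (⟨⟨i, j⟩, h⟩ | ⟨⟨i, j⟩, h⟩ | ⟨k, ⟨i, j⟩, h⟩ | ⟨⟨i, j, k⟩, h, h'⟩ |
      ⟨⟨⟨i, j⟩, h⟩, ⟨k, l⟩, h'⟩)
    · simpa [genForms, List.sortedLE_iff_pairwise] using h.le
    · simpa [genForms, List.sortedLE_iff_pairwise] using h
    · simpa [genForms, List.sortedLE_iff_pairwise] using h
    · simpa [genForms, List.sortedLE_iff_pairwise] using ⟨⟨h.le, (h.trans h').le⟩, h'.le⟩
    · simpa [genForms, List.sortedLE_iff_pairwise] using ⟨h', h.le⟩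
  intro α β h
  simp only [genWt, Prod.mk.injEq, Multiset.coe_eq_coe, and_true] at h
  exact genForms_injective (Prod.ext (h.1.eq_of_sortedLE (hs α).1 (hs β).1)
    (h.2.eq_of_sortedLE (hs α).2 (hs β).2))

theorem weight_expo {B : Type*} [AddCommMonoid B] (w : Idx (mixedDeg m n) → B)
    (L : List (Idx (mixedDeg m n))) : Finsupp.weight w (expo L) = (L.map w).sum := by
  induction L with
  | nil => simp [expo]
  | cons a L ih =>
    rw [List.map_cons, List.sum_cons, ← ih]
    simp [expo, Finsupp.weight_single]

theorem isWeightedHomogeneous_gen (α : GenIdx m n) :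
    IsWeightedHomogeneous coordWt (gen α) (genWt α) := by
  have mono : ∀ {L : List (Idx (mixedDeg m n))} {c : ℂ}, (L.map coordWt).sum = genWt α →
      IsWeightedHomogeneous coordWt (monomial (expo L) c) (genWt α) := fun {L c} h =>
    isWeightedHomogeneous_monomial _ _ _ (by rw [weight_expo, h])
  rcases α with ⟨⟨i, j⟩, h⟩ | ⟨⟨i, j⟩, h⟩ | ⟨k, ⟨i, j⟩, h⟩ | ⟨⟨i, j, k⟩, h, h'⟩ |
      ⟨⟨⟨i, j⟩, h⟩, ⟨k, l⟩, h'⟩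
  · rw [gen, linLin_expand]
    refine (mono ?_).sub (mono ?_) <;> simp [coordWt, genWt, genForms] <;> rfl
  · rw [gen, quadQuad_expand]
    refine ((mono ?_).add (mono ?_)).sub (mono ?_) <;> simp [coordWt, genWt, genForms] <;> rfl
  · rw [gen, quadLinLin_expand]
    refine (((mono ?_).add (mono ?_)).sub (mono ?_)).sub (mono ?_) <;>
      simp [coordWt, genWt, genForms] <;> rfl
  · rw [gen, quadTriple_expand]
    refine (((((mono ?_).sub (mono ?_)).add (mono ?_)).sub (mono ?_)).sub (mono ?_)).add
      (mono ?_) <;> simp [coordWt, genWt, genForms] <;> exact Multiset.cons_swap _ _ _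
  · rw [gen, quadQuadLinLin_expand]
    refine (((((((mono ?_).sub (mono ?_)).add (mono ?_)).sub (mono ?_)).sub (mono ?_)).sub
      (mono ?_)).add (mono ?_)).add (mono ?_) <;> simp [coordWt, genWt, genForms] <;>
      exact ⟨rfl, rfl⟩

theorem weight_leadExpo (α : GenIdx m n) : Finsupp.weight coordWt (leadExpo α) = genWt α := by
  by_contra h
  exact coeff_leadExpo_gen_ne_zero α ((isWeightedHomogeneous_gen α).coeff_eq_zero _ h)

theorem coeff_leadExpo_gen_of_ne {α β : GenIdx m n} (h : α ≠ β) :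
    coeff (leadExpo α) (gen β) = 0 :=
  (isWeightedHomogeneous_gen β).coeff_eq_zero _ fun e =>
    h (genWt_injective (by rw [← weight_leadExpo, e]))

theorem degree_eq_card (d : Idx (mixedDeg m n) →₀ ℕ) :
    d.degree = Multiset.card (Finsupp.weight coordWt d).1.1 +
      Multiset.card (Finsupp.weight coordWt d).1.2 := by
  induction d using Finsupp.induction_linear with
  | zero => simp
  | add d e hd he => simp only [map_add, hd, he, Prod.fst_add, Prod.snd_add, Multiset.card_add]; ring
  | single a k =>
    rw [Finsupp.degree_single, Finsupp.weight_single]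
    induction a using idx_cases with
    | lin i k => simp [coordWt]
    | quad j k => simp [coordWt]

end Weights

section Indecomposable

variable {m n : ℕ}

/-- The vector counting the coordinates `ℓᵢ₀`, `ℓᵢ₁`, `qⱼ₀`, `qⱼ₁`, `qⱼ₂` in a monomial. -/
def typeCount (d : Idx (mixedDeg m n) →₀ ℕ) : Fin 5 → ℕ :=
  Finsupp.weight (idxElim (fun _ k => ![Pi.single 0 1, Pi.single 1 1] k)
    (fun _ k => ![Pi.single 2 1, Pi.single 3 1, Pi.single 4 1] k)) d

theorem typeCount_add (d e : Idx (mixedDeg m n) →₀ ℕ) :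
    typeCount (d + e) = typeCount d + typeCount e := map_add _ _ _

theorem degree_eq_typeCount (d : Idx (mixedDeg m n) →₀ ℕ) : d.degree = typeCount d 0 +
    typeCount d 1 + typeCount d 2 + typeCount d 3 + typeCount d 4 := by
  induction d using Finsupp.induction_linear with
  | zero => simp [typeCount]
  | add d e hd he => simp only [map_add, hd, he, typeCount_add, Pi.add_apply]; ring
  | single a k =>
    rw [Finsupp.degree_single, typeCount, Finsupp.weight_single]
    induction a using idx_cases with
    | lin i k => fin_cases k <;> simp
    | quad j k => fin_cases k <;> simp

theorem torusWt_eq_typeCount (d : Idx (mixedDeg m n) →₀ ℕ) : (Finsupp.weight coordWt d).2 =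
    (typeCount d 0 - typeCount d 1 + 2 * typeCount d 2 - 2 * typeCount d 4 : ℤ) := by
  induction d using Finsupp.induction_linear with
  | zero => simp [typeCount]
  | add d e hd he =>
    simp only [map_add, Prod.snd_add, hd, he, typeCount_add, Pi.add_apply, Nat.cast_add]; ring
  | single a k =>
    rw [typeCount, Finsupp.weight_single, Finsupp.weight_single]
    induction a using idx_cases with
    | lin i k => fin_cases k <;> simp [coordWt]
    | quad j k => fin_cases k <;> simp [coordWt, mul_comm]

/-- The exponents of the monomials of torus weight zero and degree different from one; every
monomial of an invariant is of this kind. -/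
def IsBalanced (d : Idx (mixedDeg m n) →₀ ℕ) : Prop :=
  (Finsupp.weight coordWt d).2 = 0 ∧ d.degree ≠ 1

theorem IsBalanced.add {d e : Idx (mixedDeg m n) →₀ ℕ} (hd : IsBalanced d) (he : IsBalanced e) :
    IsBalanced (d + e) := by
  refine ⟨by simp [hd.1, he.1], fun h => ?_⟩
  rw [map_add] at h
  have := hd.2
  have := he.2
  omega

/-- The exponent of a distinguished monomial is not a sum of two nonzero balanced exponents. -/
theorem IsBalanced.eq_zero_or_eq_zero {α : GenIdx m n} {d e : Idx (mixedDeg m n) →₀ ℕ}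
    (hd : IsBalanced d) (he : IsBalanced e) (h : d + e = leadExpo α) : d = 0 ∨ e = 0 := by
  obtain ⟨hd₁, hd₂⟩ := hd
  obtain ⟨he₁, he₂⟩ := he
  rw [torusWt_eq_typeCount] at hd₁ he₁
  rw [← Finsupp.degree_eq_zero_iff, ← Finsupp.degree_eq_zero_iff]
  rw [degree_eq_typeCount] at *
  rw [degree_eq_typeCount] at *
  have hT : ∀ t, typeCount d t + typeCount e t = typeCount (leadExpo α) t := fun t => by
    rw [← h, typeCount_add]; rfl
  have h₀ := hT 0
  have h₁ := hT 1
  have h₂ := hT 2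
  have h₃ := hT 3
  have h₄ := hT 4
  rcases α with _ | _ | _ | _ | _ <;> simp [typeCount, leadExpo, weight_expo] at h₀ h₁ h₂ h₃ h₄ <;>
    simp only [typeCount] at * <;> omega

variable (m n) in
/-- The subalgebra of polynomials all of whose monomials are balanced. -/
def balancedAlg : Subalgebra ℂ (CoordRing m n) where
  carrier := {f | ∀ d, coeff d f ≠ 0 → IsBalanced d}
  mul_mem' := fun {f g} hf hg d hd => by
    rw [coeff_mul] at hd
    obtain ⟨⟨a, b⟩, hab, h⟩ := Finset.exists_ne_zero_of_sum_ne_zero hd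
    rw [Finset.HasAntidiagonal.mem_antidiagonal] at hab
    rw [← hab]
    exact (hf a (left_ne_zero_of_mul h)).add (hg b (right_ne_zero_of_mul h))
  add_mem' := fun {f g} hf hg d hd => by
    by_cases h : coeff d f = 0
    · exact hg d fun h' => hd (by rw [coeff_add, h, h', add_zero])
    · exact hf d h
  algebraMap_mem' := fun r d hd => by
    rw [algebraMap_eq, coeff_C] at hd
    obtain rfl : 0 = d := by by_contra h; exact hd (if_neg h)
    exact ⟨by simp, by simp⟩

theorem genAlg_le_balancedAlg : genAlg m n ≤ balancedAlg m n := by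
  refine Algebra.adjoin_le ?_
  rintro _ ⟨α, rfl⟩ d hd
  have h : Finsupp.weight coordWt d = genWt α := by
    by_contra h
    exact hd ((isWeightedHomogeneous_gen α).coeff_eq_zero _ h)
  refine ⟨by rw [h]; rfl, ?_⟩
  rw [degree_eq_card, h]
  rcases α with _ | _ | _ | _ | _ <;> simp [genWt, genForms]

theorem leadExpo_ne_zero (α : GenIdx m n) : leadExpo α ≠ 0 := fun h => by
  have := congrArg Finsupp.degree h
  rw [degree_eq_card, weight_leadExpo] at this
  rcases α with _ | _ | _ | _ | _ <;> simp [genWt, genForms] at this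

/-- The coefficient of a distinguished monomial is a point derivation on the balanced
polynomials. -/
theorem coeff_leadExpo_mul (α : GenIdx m n) {f g : CoordRing m n} (hf : f ∈ balancedAlg m n)
    (hg : g ∈ balancedAlg m n) : coeff (leadExpo α) (f * g) =
      coeff 0 f * coeff (leadExpo α) g + coeff (leadExpo α) f * coeff 0 g := by
  have h₀ := leadExpo_ne_zero α
  rw [coeff_mul, Finset.sum_eq_add (0, leadExpo α) (leadExpo α, 0)]
  · simp [h₀.symm]
  · rintro ⟨a, b⟩ hab hne
    rw [Finset.HasAntidiagonal.mem_antidiagonal] at hab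
    by_contra hc
    rcases (hf a (left_ne_zero_of_mul hc)).eq_zero_or_eq_zero (hg b (right_ne_zero_of_mul hc)) hab
      with rfl | rfl
    · exact hne.1 (by simp at hab; rw [hab])
    · exact hne.2 (by simp at hab; rw [hab])
  · simp
  · simp

/-- The coefficients of the distinguished monomials. -/
def leadCoeffs : CoordRing m n →ₗ[ℂ] GenIdx m n → ℂ := LinearMap.pi fun α => lcoeff ℂ (leadExpo α)

theorem leadCoeffs_mem_span {S : Set (CoordRing m n)} (hS : S ⊆ balancedAlg m n)
    {f : CoordRing m n} (hf : f ∈ Algebra.adjoin ℂ S) :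
    leadCoeffs f ∈ Submodule.span ℂ (leadCoeffs '' S) := by
  have hle : Algebra.adjoin ℂ S ≤ balancedAlg m n := Algebra.adjoin_le hS
  induction hf using Algebra.adjoin_induction with
  | mem f hf => exact Submodule.subset_span ⟨f, hf, rfl⟩
  | algebraMap r =>
    have : leadCoeffs (algebraMap ℂ (CoordRing m n) r) = 0 := by
      funext α
      simp [leadCoeffs, algebraMap_eq, coeff_C, (leadExpo_ne_zero α).symm]
    rw [this]
    exact zero_mem _
  | add f g _ _ hf hg => rw [map_add]; exact add_mem hf hg
  | mul f g hf' hg' hf hg =>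
    have : leadCoeffs (f * g) = coeff 0 f • leadCoeffs g + coeff 0 g • leadCoeffs f := by
      funext α
      refine (coeff_leadExpo_mul α (hle hf') (hle hg')).trans ?_
      rw [mul_comm (coeff (leadExpo α) f)]
      rfl
    rw [this]
    exact add_mem (Submodule.smul_mem _ _ hg) (Submodule.smul_mem _ _ hf)

theorem card_genIdx_le {S : Finset (CoordRing m n)}
    (hS : Algebra.adjoin ℂ (S : Set (CoordRing m n)) = genAlg m n) :
    Fintype.card (GenIdx m n) ≤ S.card := by
  classical
  have hsub : (S : Set (CoordRing m n)) ⊆ balancedAlg m n := fun f hf =>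
    genAlg_le_balancedAlg (hS ▸ Algebra.subset_adjoin hf)
  have htop : Submodule.span ℂ ((S.image leadCoeffs : Finset (GenIdx m n → ℂ)) : Set (GenIdx m n → ℂ)) = ⊤ := by
    rw [eq_top_iff, ← (Pi.basisFun ℂ (GenIdx m n)).span_eq, Submodule.span_le, Finset.coe_image]
    rintro _ ⟨α, rfl⟩
    have h : gen α ∈ Algebra.adjoin ℂ (S : Set (CoordRing m n)) :=
      hS ▸ Algebra.subset_adjoin ⟨α, rfl⟩
    have e : Pi.basisFun ℂ (GenIdx m n) α =
        (coeff (leadExpo α) (gen α))⁻¹ • leadCoeffs (gen α) := by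
      funext β
      by_cases hβ : β = α
      · subst hβ
        simpa [leadCoeffs] using (inv_mul_cancel₀ (coeff_leadExpo_gen_ne_zero β)).symm
      · simp [leadCoeffs, coeff_leadExpo_gen_of_ne hβ, hβ]
    rw [e]
    exact Submodule.smul_mem _ _ (leadCoeffs_mem_span hsub h)
  calc Fintype.card (GenIdx m n) = Module.finrank ℂ (GenIdx m n → ℂ) := by simp
    _ = Module.finrank ℂ (Submodule.span ℂ
        ((S.image leadCoeffs : Finset (GenIdx m n → ℂ)) : Set (GenIdx m n → ℂ))) := by rw [htop, finrank_top]
    _ ≤ (S.image (leadCoeffs : CoordRing m n → GenIdx m n → ℂ)).card :=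
        finrank_span_finset_le_card _
    _ ≤ S.card := Finset.card_image_le

theorem isMinimalNumGens_card :
    IsMinimalNumGens (mixedDeg m n) (Fintype.card (GenIdx m n)) := by
  classical
  have h : Algebra.adjoin ℂ ((Finset.univ.image gen : Finset (CoordRing m n)) : Set _) =
      genAlg m n := by simp [genAlg]
  refine ⟨⟨Finset.univ.image gen, ?_, h.trans genAlg_eq_invariantRing⟩, ?_⟩
  · exact le_antisymm Finset.card_image_le (card_genIdx_le h)
  · rintro _ ⟨S, rfl, hS⟩
    exact card_genIdx_le (hS.trans genAlg_eq_invariantRing.symm)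

end Indecomposable

section Counting

theorem card_orderEmbedding (k n : ℕ) : Nat.card (Fin k ↪o Fin n) = n.choose k := by
  rw [Nat.card_congr Set.powersetCard.ofFinEmbEquiv, Set.powersetCard.card, Nat.card_fin]

theorem card_lt_pairs (n : ℕ) :
    Fintype.card {p : Fin n × Fin n // p.1 < p.2} = n.choose 2 := by
  rw [← card_orderEmbedding, ← Nat.card_eq_fintype_card]
  refine (Nat.card_congr (Equiv.ofBijective
    (fun f : Fin 2 ↪o Fin n => ⟨(f 0, f 1), f.strictMono (by decide)⟩) ⟨fun f g h => ?_, ?_⟩)).symm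
  · ext i
    simp only [Subtype.mk.injEq, Prod.mk.injEq] at h
    fin_cases i <;> simp [h]
  · rintro ⟨⟨i, j⟩, h⟩
    have : StrictMono ![i, j] := by simpa [Subsingleton.strictMono] using h
    exact ⟨OrderEmbedding.ofStrictMono _ this, rfl⟩

theorem card_lt_triples (n : ℕ) :
    Fintype.card {p : Fin n × Fin n × Fin n // p.1 < p.2.1 ∧ p.2.1 < p.2.2} = n.choose 3 := by
  rw [← card_orderEmbedding, ← Nat.card_eq_fintype_card]
  refine (Nat.card_congr (Equiv.ofBijective
    (fun f : Fin 3 ↪o Fin n =>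
      ⟨(f 0, f 1, f 2), f.strictMono (by decide), f.strictMono (by decide)⟩)
    ⟨fun f g h => ?_, ?_⟩)).symm
  · ext i
    simp only [Subtype.mk.injEq, Prod.mk.injEq] at h
    fin_cases i <;> simp [h]
  · rintro ⟨⟨i, j, k⟩, h⟩
    have : StrictMono ![i, j, k] := by simpa [Subsingleton.strictMono] using h
    exact ⟨OrderEmbedding.ofStrictMono _ this, rfl⟩

theorem card_le_pairs (n : ℕ) :
    Fintype.card {p : Fin n × Fin n // p.1 ≤ p.2} = (n + 1).choose 2 := by
  rw [← Fintype.card_congr Sym2.sortEquiv, Sym2.card, Fintype.card_fin]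

theorem card_genIdx (m n : ℕ) : Fintype.card (GenIdx m n) =
    n.choose 3 + (m + 1).choose 2 * (n + 1).choose 2 + m.choose 2 + (n + 1).choose 2 := by
  simp only [Fintype.card_sum, Fintype.card_prod, card_lt_pairs, card_lt_triples, card_le_pairs,
    Fintype.card_fin]
  rw [Nat.choose_succ_succ' n 1, Nat.choose_one_right]
  ring

end Counting

end BinInv

open BinInv in
/-- For `V = m·V₁ ⊕ n·V₂` (`m, n ≥ 1`), the invariant ring is generated by
`(ℓᵢ,ℓⱼ)₁` (`i < j`), `(qᵢ,qⱼ)₂` (`i ≤ j`), `(q_k, ℓᵢℓⱼ)₂` (`i ≤ j`),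
`(qᵢ,(qⱼ,q_k)₁)₂` (`i < j < k`) and `((qᵢ,qⱼ)₁, ℓ_kℓ_l)₂` (`i < j`, `k ≤ l`),
and its minimal number of generators is
`C(n,3) + C(m+1,2)·C(n+1,2) + C(m,2) + C(n+1,2)`. -/
theorem mV1_nV2_generators (m n : ℕ) (hm : 1 ≤ m) (hn : 1 ≤ n) :
    Algebra.adjoin ℂ
        {P : MvPolynomial (Idx (mixedDeg m n)) ℂ |
          (∃ i j : Fin m, i < j ∧
            P = constantCoeff (transvectant 1 1 1 (Lform m n i) (Lform m n j))) ∨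
          (∃ i j : Fin n, i ≤ j ∧
            P = constantCoeff (transvectant 2 2 2 (Qform m n i) (Qform m n j))) ∨
          (∃ (k : Fin n) (i j : Fin m), i ≤ j ∧
            P = constantCoeff (transvectant 2 2 2 (Qform m n k) (Lform m n i * Lform m n j))) ∨
          (∃ i j k : Fin n, i < j ∧ j < k ∧
            P = constantCoeff (transvectant 2 2 2 (Qform m n i)
              (transvectant 2 2 1 (Qform m n j) (Qform m n k)))) ∨
          (∃ (i j : Fin n) (k l : Fin m), i < j ∧ k ≤ l ∧
            P = constantCoeff (transvectant 2 2 2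
              (transvectant 2 2 1 (Qform m n i) (Qform m n j))
              (Lform m n k * Lform m n l)))} =
      invariantRing (mixedDeg m n) ∧
    IsMinimalNumGens (mixedDeg m n)
      (n.choose 3 + (m + 1).choose 2 * (n + 1).choose 2 + m.choose 2 + (n + 1).choose 2) := by
  rw [transvectant_generators_eq_range_gen, ← card_genIdx]
  exact ⟨genAlg_eq_invariantRing, isMinimalNumGens_card⟩
end
end

section
/- Let R = ⊕_{i≥0} R_i be a finitely generated graded commutative ℂ-algebra with R_0 = ℂ that is an integral domain, and set a_i = dim_ℂ R_i. Let i > 0 and suppose 0 < j < i with a_j ≠ 0. Then the number of degree-i elements required in any homogeneous generating set of R, namely dim_ℂ of the degree-i component of R_+/(R_+·R_+) (where R_+ = ⊕_{d>0} R_d), is at most a_i − a_{i−j}. -/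
namespace GradedAlgebra

/-- In a graded algebra of finite type over a Noetherian ring whose degree-zero part is finite,
every graded component is finite. -/
theorem finite_component {R A : Type*} [CommRing R] [IsNoetherianRing R] [CommRing A]
    [Algebra R A] [Algebra.FiniteType R A] (𝒜 : ℕ → Submodule R A) [GradedAlgebra 𝒜]
    (h0 : (𝒜 0).FG) (n : ℕ) : Module.Finite R (𝒜 n) := by
  have : IsNoetherianRing A := Algebra.FiniteType.isNoetherianRing R A
  have hfg : (Submodule.span A (⋃ d > 0, (𝒜 d : Set A))).FG := IsNoetherian.noetherian _
  obtain ⟨S, hS, hspan⟩ := Submodule.fg_span_iff_fg_span_finset_subset _ |>.mp hfg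
  induction n using Nat.strong_induction_on with
  | _ n ih =>
    obtain rfl | hn := Nat.eq_zero_or_pos n
    · exact Module.Finite.iff_fg.mpr h0
    let N : Submodule R A := Submodule.span R (S : Set A) * ⨆ d : Fin n, 𝒜 d
    have hN : N.FG := (Submodule.fg_span S.finite_toSet).mul <|
      Submodule.fg_iSup _ fun d ↦ Module.Finite.iff_fg.mp (ih d d.2)
    have key : ∀ a ∈ Submodule.span A (S : Set A), (DirectSum.decompose 𝒜 a n : A) ∈ N := by
      intro a ha
      induction ha using Submodule.closure_induction with
      | zero => simp
      | add x y _ _ hx hy => simpa using add_mem hx hy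
      | smul_mem c x hx =>
        obtain ⟨d, hd, hxd⟩ := Set.mem_iUnion₂.mp (hS hx)
        rw [smul_eq_mul, DirectSum.coe_decompose_mul_of_right_mem 𝒜 n hxd]
        split_ifs
        · rw [mul_comm]
          exact Submodule.mul_mem_mul (Submodule.subset_span hx) <|
            Submodule.mem_iSup_of_mem (⟨n - d, Nat.sub_lt hn hd⟩ : Fin n) (SetLike.coe_mem _)
        · exact zero_mem N
    have hle : 𝒜 n ≤ N := by
      intro a ha
      rw [← DirectSum.decompose_of_mem_same 𝒜 ha]
      refine key a (hspan ▸ Submodule.subset_span ?_)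
      exact Set.mem_biUnion hn ha
    have := isNoetherian_of_fg_of_noetherian N hN
    exact Module.Finite.of_injective _ (Submodule.inclusion_injective hle)

end GradedAlgebra

/-- If `W` embeds into `U ⊓ P`, then the image of `U` in `V ⧸ P` has dimension at most
`dim U - dim W`. -/
theorem finrank_map_mkQ_add_finrank_le {K V W : Type*} [Field K] [AddCommGroup V] [Module K V]
    [AddCommGroup W] [Module K W] (P U : Submodule K V) [FiniteDimensional K U]
    (f : W →ₗ[K] V) (hf : Function.Injective f) (hfU : ∀ w, f w ∈ U) (hfP : ∀ w, f w ∈ P) :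
    Module.finrank K (U.map P.mkQ) + Module.finrank K W ≤ Module.finrank K U := by
  rw [← (P.mkQ.domRestrict U).finrank_range_add_finrank_ker, LinearMap.range_domRestrict]
  refine Nat.add_le_add_left ?_ _
  let g : W →ₗ[K] LinearMap.ker (P.mkQ.domRestrict U) :=
    (f.codRestrict U hfU).codRestrict _ fun w ↦ by simpa using hfP w
  refine LinearMap.finrank_le_finrank_of_injective (f := g) fun x y h ↦ hf ?_
  exact congrArg (fun z ↦ (z.1 : V)) h

/-- Let `R = ⊕ Rᵢ` be a finitely generated graded `ℂ`-algebra domain with `R₀ = ℂ` and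
`aᵢ = dim Rᵢ`. For `0 < j < i` with `aⱼ ≠ 0`, the number of degree-`i` elements needed
in any homogeneous generating set — the dimension of the degree-`i` component of
`R₊/(R₊·R₊)`, i.e. of the image of `Rᵢ` in `R/(R₊·R₊)` — is at most `aᵢ − a_{i−j}`. -/
theorem degree_i_generators_bound (A : Type*) [CommRing A] [Algebra ℂ A] [IsDomain A]
    (𝒜 : ℕ → Submodule ℂ A) [GradedAlgebra 𝒜]
    (hfg : Algebra.FiniteType ℂ A) (h0 : 𝒜 0 = 1)
    (i j : ℕ) (hj : 0 < j) (hji : j < i)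
    (haj : Module.finrank ℂ ↥(𝒜 j) ≠ 0) :
    Module.finrank ℂ
        ↥(Submodule.map
            ((⨆ d ∈ Set.Ioi (0 : ℕ), 𝒜 d) * (⨆ d ∈ Set.Ioi (0 : ℕ), 𝒜 d)).mkQ (𝒜 i)) ≤
      Module.finrank ℂ ↥(𝒜 i) - Module.finrank ℂ ↥(𝒜 (i - j)) := by
  have := hfg
  have : Module.Finite ℂ (𝒜 i) :=
    GradedAlgebra.finite_component 𝒜
      (h0 ▸ Submodule.one_eq_span (R := ℂ) (A := A) ▸ Submodule.fg_span_singleton 1) i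
  have : Nontrivial (𝒜 j) := Module.nontrivial_of_finrank_pos (Nat.pos_of_ne_zero haj)
  obtain ⟨⟨a, ha⟩, hane⟩ := exists_ne (0 : 𝒜 j)
  have ha0 : a ≠ 0 := fun h ↦ hane (Subtype.ext h)
  refine Nat.le_sub_of_add_le <| finrank_map_mkQ_add_finrank_le _ _
    ((LinearMap.mulLeft ℂ a).domRestrict (𝒜 (i - j))) ?_ ?_ ?_
  · exact fun x y h ↦ Subtype.ext (mul_left_cancel₀ ha0 h)
  · intro w
    have := SetLike.mul_mem_graded ha w.2
    rwa [Nat.add_sub_of_le hji.le] at this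
  · have hmem {d : ℕ} (hd : 0 < d) : 𝒜 d ≤ ⨆ d ∈ Set.Ioi (0 : ℕ), 𝒜 d :=
      le_biSup 𝒜 hd
    exact fun w ↦ Submodule.mul_mem_mul (hmem hj ha) (hmem (Nat.sub_pos_of_lt hji) w.2)
end

section
/- Let V = 2V_1 ⊕ V_3 (two linear forms and one cubic form) and R = O(V)^{SL(2,ℂ)}. Then R has a homogeneous system of parameters consisting of five invariants, of degrees 2, 4, 4, 4, 4. -/
open MvPolynomial

section Valuation

variable {K Γ : Type*} [Field K] [LinearOrderedCommGroupWithZero Γ] (v : Valuation K Γ)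

theorem Valuation.hessian_or_cubic_eq {a b : K} (h : v b ≤ v a) :
    v (a ^ 2 - a * b + b ^ 2) = v a ^ 2 ∨ v (a * b * (a - b)) = v a ^ 3 := by
  rcases eq_or_ne (v a) 0 with ha | ha
  · have hb : v b = 0 := le_antisymm (ha ▸ h) zero_le
    right; simp [ha]
  have hpos : 0 < v a := zero_lt_iff.2 ha
  rcases h.lt_or_eq with h | h
  · left
    have : a ^ 2 - a * b + b ^ 2 = a ^ 2 + b * (b - a) := by ring
    rw [this, Valuation.map_add_eq_of_lt_left, map_pow]
    rw [map_mul, map_pow, Valuation.map_sub_eq_of_lt_right v h, sq]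
    gcongr
  · have h' : v (a - b) ≤ v a := v.map_sub_le le_rfl h.le
    rcases h'.lt_or_eq with h' | h'
    · left
      have : a ^ 2 - a * b + b ^ 2 = a * b + (a - b) ^ 2 := by ring
      rw [this, Valuation.map_add_eq_of_lt_left, map_mul, h, sq]
      rw [map_mul, map_pow, h, ← sq]
      exact pow_lt_pow_left₀ h' zero_le two_ne_zero
    · right
      rw [map_mul, map_mul, h', h, pow_three']

theorem Valuation.hessian_le {a b : K} {t : Γ} (ha : v a ≤ t) (hb : v b ≤ t) :
    v (a ^ 2 - a * b + b ^ 2) ≤ t ^ 2 := by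
  refine v.map_add_le (v.map_sub_le ?_ ?_) ?_
  · rw [map_pow]; exact pow_le_pow_left₀ zero_le ha 2
  · rw [map_mul, sq]; exact mul_le_mul' ha hb
  · rw [map_pow]; exact pow_le_pow_left₀ zero_le hb 2

theorem Valuation.first_dominant {l a₀ a₁ b₀ b₁ : K} (hl : v l ≤ 1) (ha : 1 < v a₀)
    (ha₁ : v a₁ ≤ v a₀) (hb₀ : v b₀ ≤ v a₀) (hb₁ : v b₁ ≤ v a₀)
    (hH : v (l ^ 2 * (a₀ ^ 2 - a₀ * a₁ + a₁ ^ 2)) ≤ 1)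
    (hF : v (l * (a₀ * a₁ * (a₀ - a₁)) + l ^ 2 * (b₀ ^ 2 - b₀ * b₁ + b₁ ^ 2)) ≤ 1) :
    v (l * a₀) ≤ 1 ∧ v (l * (a₀ * a₁ * (a₀ - a₁))) ≤ 1 := by
  have key : v (l * a₀) ≤ 1 := by
    rcases v.hessian_or_cubic_eq ha₁ with h | h
    · rw [map_mul, h, map_pow, ← mul_pow, ← map_mul] at hH
      exact (pow_le_one_iff_of_nonneg zero_le two_ne_zero).1 hH
    · by_contra! hc
      have hl0 : 0 < v l := by
        refine zero_lt_iff.2 fun h0 => ?_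
        rw [map_mul, h0, zero_mul] at hc
        exact absurd hc (by simp)
      have hlt : v (l ^ 2 * (b₀ ^ 2 - b₀ * b₁ + b₁ ^ 2)) < v (l * (a₀ * a₁ * (a₀ - a₁))) := by
        rw [map_mul, map_mul, h, map_pow]
        calc v l ^ 2 * v (b₀ ^ 2 - b₀ * b₁ + b₁ ^ 2) ≤ v l ^ 2 * v a₀ ^ 2 := by
              gcongr; exact v.hessian_le hb₀ hb₁
          _ = v l * (v l * v a₀ ^ 2) := by simp only [pow_succ, pow_zero, one_mul]; ac_rfl
          _ ≤ v l * (1 * v a₀ ^ 2) := by gcongr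
          _ < v l * (v a₀ * v a₀ ^ 2) := by
            have := pow_pos (zero_lt_one.trans ha) 2
            gcongr
          _ = v l * v a₀ ^ 3 := by simp only [pow_succ, pow_zero, one_mul]; ac_rfl
      rw [Valuation.map_add_eq_of_lt_left _ hlt, map_mul, h] at hF
      refine absurd hF (not_le.2 (hc.trans_le ?_))
      rw [map_mul]
      gcongr
      exact le_self_pow₀ ha.le (by norm_num)
  refine ⟨key, ?_⟩
  have h2 : v (l ^ 2 * (b₀ ^ 2 - b₀ * b₁ + b₁ ^ 2)) ≤ 1 := by
    rw [map_mul, map_pow]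
    calc v l ^ 2 * v (b₀ ^ 2 - b₀ * b₁ + b₁ ^ 2) ≤ v l ^ 2 * v a₀ ^ 2 := by
              gcongr; exact v.hessian_le hb₀ hb₁
      _ = v (l * a₀) ^ 2 := by rw [map_mul, mul_pow]
      _ ≤ 1 := pow_le_one' key 2
  simpa using v.map_sub_le hF h2

theorem Valuation.second_dominant {l a₀ a₁ b₀ b₁ : K} (hb : 1 < v b₀)
    (hb₁ : v b₁ ≤ v b₀) (ha₀ : v a₀ < v b₀)
    (hD : v (a₀ * b₁ - a₁ * b₀) ≤ 1)
    (hG : v (l * (b₀ * b₁ * (b₀ - b₁))) ≤ 1)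
    (hF : v (l * (a₀ * a₁ * (a₀ - a₁)) + l ^ 2 * (b₀ ^ 2 - b₀ * b₁ + b₁ ^ 2)) ≤ 1) :
    v (l * b₀) ≤ 1 := by
  rcases v.hessian_or_cubic_eq hb₁ with h | h
  · by_contra! hc
    have hb0 : 0 < v b₀ := zero_lt_one.trans hb
    have hl0 : 0 < v l := by
      refine zero_lt_iff.2 fun h0 => ?_
      rw [map_mul, h0, zero_mul] at hc
      exact absurd hc (by simp)
    have hLB : 1 < v l * v b₀ := by rwa [map_mul] at hc
    have hLB2 : v l * v b₀ < v l ^ 2 * v b₀ ^ 2 := by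
      rw [← mul_pow, sq]
      exact lt_mul_of_one_lt_left (zero_lt_one.trans hLB) hLB
    have hlt : v (l * (a₀ * a₁ * (a₀ - a₁))) < v (l ^ 2 * (b₀ ^ 2 - b₀ * b₁ + b₁ ^ 2)) := by
      rw [map_mul _ (l ^ 2), h, map_pow]
      have hid : b₀ ^ 3 * (l * (a₀ * a₁ * (a₀ - a₁))) =
          a₀ ^ 3 * (l * (b₀ * b₁ * (b₀ - b₁))) -
          l * (a₀ ^ 2 * b₀ * (a₀ * b₁ - a₁ * b₀) * (b₀ - b₁ - b₁)) -
          l * (a₀ * b₀ * (a₀ * b₁ - a₁ * b₀) ^ 2) := by ring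
      have hb3 : 0 < v b₀ ^ 3 := pow_pos hb0 3
      refine lt_of_mul_lt_mul_left (a := v b₀ ^ 3) ?_ hb3.le
      rw [← map_pow, ← map_mul, hid, map_pow]
      set D := a₀ * b₁ - a₁ * b₀
      refine v.map_sub_lt (v.map_sub_lt ?_ ?_) ?_
      · rw [map_mul, map_pow]
        calc v a₀ ^ 3 * v (l * (b₀ * b₁ * (b₀ - b₁))) ≤ v b₀ ^ 3 * 1 := by gcongr
          _ < v b₀ ^ 3 * (v l ^ 2 * v b₀ ^ 2) := by
            gcongr; exact hLB.trans hLB2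
      · have h3 : v (b₀ - b₁ - b₁) ≤ v b₀ :=
          v.map_sub_le (v.map_sub_le le_rfl hb₁) hb₁
        simp only [map_mul, map_pow]
        calc v l * (v a₀ ^ 2 * v b₀ * v D * v (b₀ - b₁ - b₁))
            ≤ v l * (v b₀ ^ 2 * v b₀ * 1 * v b₀) := by gcongr
          _ = v b₀ ^ 3 * (v l * v b₀) := by simp only [pow_succ, pow_zero, one_mul]; ac_rfl
          _ < v b₀ ^ 3 * (v l ^ 2 * v b₀ ^ 2) := by gcongr
      · simp only [map_mul, map_pow]
        calc v l * (v a₀ * v b₀ * v D ^ 2)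
            ≤ v l * (v b₀ * v b₀ * 1 ^ 2) := by gcongr
          _ = v b₀ * 1 * (v l * v b₀) := by simp only [pow_succ, pow_zero, one_mul]; ac_rfl
          _ ≤ v b₀ * (v b₀ * v b₀) * (v l * v b₀) := by
            gcongr
            exact one_le_mul hb.le hb.le
          _ = v b₀ ^ 3 * (v l * v b₀) := by simp only [pow_succ, pow_zero, one_mul]; ac_rfl
          _ < v b₀ ^ 3 * (v l ^ 2 * v b₀ ^ 2) := by gcongr
    rw [Valuation.map_add_eq_of_lt_right _ hlt, map_mul _ (l ^ 2), h, map_pow] at hF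
    exact absurd hF (not_le.2 (hLB.trans hLB2))
  · rw [map_mul, h] at hG
    refine le_trans ?_ hG
    rw [map_mul]
    gcongr
    exact le_self_pow₀ hb.le (by norm_num)

/-- Some unimodular substitution makes the linear forms `a₀ x + a₁ y`, `b₀ x + b₁ y` and the cubic
form `-l x y (x + y)` integral for `v`. -/
def Valuation.HasIntegralModel (l a₀ a₁ b₀ b₁ : K) : Prop :=
  ∃ a b c d : K, a * d - b * c = 1 ∧
    (v (a₀ * a + a₁ * c) ≤ 1 ∧ v (a₀ * b + a₁ * d) ≤ 1) ∧
    (v (b₀ * a + b₁ * c) ≤ 1 ∧ v (b₀ * b + b₁ * d) ≤ 1) ∧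
    v (-l * (a * c * (a + c))) ≤ 1 ∧
    v (-l * (2 * a * b * c + a ^ 2 * d + 2 * a * c * d + b * c ^ 2)) ≤ 1 ∧
    v (-l * (b ^ 2 * c + 2 * a * b * d + a * d ^ 2 + 2 * b * c * d)) ≤ 1 ∧
    v (-l * (b * d * (b + d))) ≤ 1

variable {v}

theorem Valuation.HasIntegralModel.swap {l a₀ a₁ b₀ b₁ : K}
    (h : v.HasIntegralModel l a₀ a₁ b₀ b₁) : v.HasIntegralModel l b₀ b₁ a₀ a₁ := by
  obtain ⟨a, b, c, d, hdet, h1, h2, h3⟩ := h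
  exact ⟨a, b, c, d, hdet, h2, h1, h3⟩

theorem Valuation.HasIntegralModel.reflect {l a₀ a₁ b₀ b₁ : K}
    (h : v.HasIntegralModel (-l) a₁ a₀ b₁ b₀) : v.HasIntegralModel l a₀ a₁ b₀ b₁ := by
  obtain ⟨a, b, c, d, hdet, ⟨h1, h2⟩, ⟨h3, h4⟩, h5, h6, h7, h8⟩ := h
  refine ⟨d, c, b, a, by linear_combination hdet, ⟨?_, ?_⟩, ⟨?_, ?_⟩, ?_, ?_, ?_, ?_⟩
  · convert h2 using 2; ring
  · convert h1 using 2; ring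
  · convert h4 using 2; ring
  · convert h3 using 2; ring
  · rw [← v.map_neg]; convert h8 using 2; ring
  · rw [← v.map_neg]; convert h7 using 2; ring
  · rw [← v.map_neg]; convert h6 using 2; ring
  · rw [← v.map_neg]; convert h5 using 2; ring

theorem Valuation.hasIntegralModel_of_dominant {l a₀ a₁ b₀ b₁ : K} (hl : v l ≤ 1)
    (ha : 1 < v a₀) (ha₁ : v a₁ ≤ v a₀) (hb₀ : v b₀ ≤ v a₀)
    (hD : v (a₀ * b₁ - a₁ * b₀) ≤ 1) (hla : v (l * a₀) ≤ 1)
    (hF : v (l * (a₀ * a₁ * (a₀ - a₁))) ≤ 1) : v.HasIntegralModel l a₀ a₁ b₀ b₁ := by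
  have hpos : 0 < v a₀ := zero_lt_one.trans ha
  have h0 : a₀ ≠ 0 := v.pos_iff.1 hpos
  refine ⟨a₀⁻¹, -a₁, 0, a₀, by field_simp; ring, ⟨?_, ?_⟩, ⟨?_, ?_⟩, ?_, ?_, ?_, ?_⟩
  · simp [h0]
  · have : a₀ * -a₁ + a₁ * a₀ = 0 := by ring
    rw [this, map_zero]; exact zero_le
  · rw [mul_zero, add_zero, map_mul, map_inv₀]
    exact mul_inv_le_one_of_le₀ hb₀ zero_le
  · convert hD using 2; ring
  · simp
  · have : -l * (2 * a₀⁻¹ * -a₁ * 0 + a₀⁻¹ ^ 2 * a₀ + 2 * a₀⁻¹ * 0 * a₀ + -a₁ * 0 ^ 2)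
        = -(l * a₀⁻¹) := by field_simp; ring
    rw [this, v.map_neg, map_mul, map_inv₀]
    exact mul_inv_le_one_of_le₀ (hl.trans ha.le) zero_le
  · have : -l * ((-a₁) ^ 2 * 0 + 2 * a₀⁻¹ * -a₁ * a₀ + a₀⁻¹ * a₀ ^ 2 + 2 * -a₁ * 0 * a₀)
        = l * a₁ + l * a₁ - l * a₀ := by field_simp; ring
    rw [this]
    have h1 : v (l * a₁) ≤ 1 := by
      refine le_trans ?_ hla
      rw [map_mul, map_mul]
      gcongr
    exact v.map_sub_le (v.map_add_le h1 h1) hla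
  · convert hF using 2; ring

theorem Valuation.hasIntegralModel {l a₀ a₁ b₀ b₁ : K} (hl : v l ≤ 1)
    (hD : v (a₀ * b₁ - a₁ * b₀) ≤ 1)
    (hH : v (l ^ 2 * (a₀ ^ 2 - a₀ * a₁ + a₁ ^ 2)) ≤ 1)
    (hG : v (l * (b₀ * b₁ * (b₀ - b₁))) ≤ 1)
    (hF : v (l * (a₀ * a₁ * (a₀ - a₁)) + l ^ 2 * (b₀ ^ 2 - b₀ * b₁ + b₁ ^ 2)) ≤ 1) :
    v.HasIntegralModel l a₀ a₁ b₀ b₁ := by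
  wlog hle : max (v a₁) (v b₁) ≤ max (v a₀) (v b₀) generalizing l a₀ a₁ b₀ b₁
  · refine (this (l := -l) (by rwa [v.map_neg]) ?_ ?_ ?_ ?_ (le_of_not_ge hle)).reflect
    · rw [← v.map_neg]; convert hD using 2; ring
    · convert hH using 2; ring
    · convert hG using 2; ring
    · convert hF using 2; ring
  rcases le_or_gt (max (v a₀) (v b₀)) 1 with h1 | h1
  · obtain ⟨h2, h3⟩ := max_le_iff.1 (hle.trans h1)
    obtain ⟨h4, h5⟩ := max_le_iff.1 h1
    exact ⟨1, 0, 0, 1, by ring, by simpa using ⟨h4, h2⟩, by simpa using ⟨h5, h3⟩, by simpa using hl⟩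
  rcases le_or_gt (v b₀) (v a₀) with h2 | h2
  · rw [max_eq_left h2] at h1 hle
    obtain ⟨h3, h4⟩ := max_le_iff.1 hle
    obtain ⟨h5, h6⟩ := v.first_dominant hl h1 h3 h2 h4 hH hF
    exact hasIntegralModel_of_dominant hl h1 h3 h2 hD h5 h6
  · rw [max_eq_right h2.le] at h1 hle
    obtain ⟨h3, h4⟩ := max_le_iff.1 hle
    refine (hasIntegralModel_of_dominant hl h1 h4 h2.le ?_
      (v.second_dominant h1 h4 h2 hD hG hF) hG).swap
    rw [← v.map_neg]; convert hD using 2; ring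

end Valuation

namespace BinInv

section Coordinates

variable {A B : Type*} [CommRing A] [CommRing B]

/-- The pair of linear forms `a₀ x + a₁ y`, `b₀ x + b₁ y` together with the cubic form
`c₀ x³ + c₁ x²y + c₂ xy² + c₃ y³`, as a coefficient vector. -/
def pt (a₀ a₁ b₀ b₁ c₀ c₁ c₂ c₃ : A) : Idx ![1, 1, 3] → A := fun j =>
  (![![a₀, a₁, 0, 0], ![b₀, b₁, 0, 0], ![c₀, c₁, c₂, c₃]] : Fin 3 → Fin 4 → A) j.1
    (Fin.ofNat 4 j.2)

theorem forall_idx {p : Idx ![1, 1, 3] → Prop} :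
    (∀ j, p j) ↔ (p ⟨0, (0 : Fin 2)⟩ ∧ p ⟨0, (1 : Fin 2)⟩) ∧
      (p ⟨1, (0 : Fin 2)⟩ ∧ p ⟨1, (1 : Fin 2)⟩) ∧
      p ⟨2, (0 : Fin 4)⟩ ∧ p ⟨2, (1 : Fin 4)⟩ ∧ p ⟨2, (2 : Fin 4)⟩ ∧ p ⟨2, (3 : Fin 4)⟩ := by
  refine ⟨fun h => ⟨⟨h _, h _⟩, ⟨h _, h _⟩, h _, h _, h _, h _⟩, ?_⟩
  rintro ⟨⟨h1, h2⟩, ⟨h3, h4⟩, h5, h6, h7, h8⟩ ⟨i, k⟩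
  fin_cases i <;> fin_cases k <;> assumption

theorem exists_eq_pt (v : Idx ![1, 1, 3] → A) :
    ∃ a₀ a₁ b₀ b₁ c₀ c₁ c₂ c₃ : A, v = pt a₀ a₁ b₀ b₁ c₀ c₁ c₂ c₃ :=
  ⟨v ⟨0, (0 : Fin 2)⟩, v ⟨0, (1 : Fin 2)⟩, v ⟨1, (0 : Fin 2)⟩, v ⟨1, (1 : Fin 2)⟩,
    v ⟨2, (0 : Fin 4)⟩, v ⟨2, (1 : Fin 4)⟩, v ⟨2, (2 : Fin 4)⟩, v ⟨2, (3 : Fin 4)⟩,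
    funext (forall_idx.2 ⟨⟨rfl, rfl⟩, ⟨rfl, rfl⟩, rfl, rfl, rfl, rfl⟩)⟩

/-- The substitution `x ↦ a x + b y`, `y ↦ c x + d y` in coefficient coordinates. -/
def subst (a b c d : A) (v : Idx ![1, 1, 3] → A) : Idx ![1, 1, 3] → A :=
  let a₀ := v ⟨0, (0 : Fin 2)⟩
  let a₁ := v ⟨0, (1 : Fin 2)⟩
  let b₀ := v ⟨1, (0 : Fin 2)⟩
  let b₁ := v ⟨1, (1 : Fin 2)⟩
  let c₀ := v ⟨2, (0 : Fin 4)⟩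
  let c₁ := v ⟨2, (1 : Fin 4)⟩
  let c₂ := v ⟨2, (2 : Fin 4)⟩
  let c₃ := v ⟨2, (3 : Fin 4)⟩
  pt (a₀ * a + a₁ * c) (a₀ * b + a₁ * d) (b₀ * a + b₁ * c) (b₀ * b + b₁ * d)
    (c₀ * a ^ 3 + c₁ * (a ^ 2 * c) + c₂ * (a * c ^ 2) + c₃ * c ^ 3)
    (c₀ * (3 * a ^ 2 * b) + c₁ * (2 * a * b * c + a ^ 2 * d) +
      c₂ * (2 * a * c * d + b * c ^ 2) + c₃ * (3 * c ^ 2 * d))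
    (c₀ * (3 * a * b ^ 2) + c₁ * (b ^ 2 * c + 2 * a * b * d) +
      c₂ * (a * d ^ 2 + 2 * b * c * d) + c₃ * (3 * c * d ^ 2))
    (c₀ * b ^ 3 + c₁ * (b ^ 2 * d) + c₂ * (b * d ^ 2) + c₃ * d ^ 3)

theorem subst_pt (a b c d a₀ a₁ b₀ b₁ c₀ c₁ c₂ c₃ : A) :
    subst a b c d (pt a₀ a₁ b₀ b₁ c₀ c₁ c₂ c₃) =
      pt (a₀ * a + a₁ * c) (a₀ * b + a₁ * d) (b₀ * a + b₁ * c) (b₀ * b + b₁ * d)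
        (c₀ * a ^ 3 + c₁ * (a ^ 2 * c) + c₂ * (a * c ^ 2) + c₃ * c ^ 3)
        (c₀ * (3 * a ^ 2 * b) + c₁ * (2 * a * b * c + a ^ 2 * d) +
          c₂ * (2 * a * c * d + b * c ^ 2) + c₃ * (3 * c ^ 2 * d))
        (c₀ * (3 * a * b ^ 2) + c₁ * (b ^ 2 * c + 2 * a * b * d) +
          c₂ * (a * d ^ 2 + 2 * b * c * d) + c₃ * (3 * c * d ^ 2))
        (c₀ * b ^ 3 + c₁ * (b ^ 2 * d) + c₂ * (b * d ^ 2) + c₃ * d ^ 3) :=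
  rfl

theorem map_pt (φ : A →+* B) (a₀ a₁ b₀ b₁ c₀ c₁ c₂ c₃ : A) :
    φ ∘ pt a₀ a₁ b₀ b₁ c₀ c₁ c₂ c₃ =
      pt (φ a₀) (φ a₁) (φ b₀) (φ b₁) (φ c₀) (φ c₁) (φ c₂) (φ c₃) :=
  funext (forall_idx.2 ⟨⟨rfl, rfl⟩, ⟨rfl, rfl⟩, rfl, rfl, rfl, rfl⟩)

theorem map_subst (φ : A →+* B) (a b c d : A) (v : Idx ![1, 1, 3] → A) :
    φ ∘ subst a b c d v = subst (φ a) (φ b) (φ c) (φ d) (φ ∘ v) := by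
  obtain ⟨a₀, a₁, b₀, b₁, c₀, c₁, c₂, c₃, rfl⟩ := exists_eq_pt v
  rw [subst_pt, map_pt, map_pt, subst_pt]
  simp only [map_add, map_mul, map_pow, map_ofNat]

end Coordinates

theorem coeffAt_formAt {p : ℕ} (n : Fin p → ℕ) (c : Idx n → ℂ) (j : Idx n) :
    coeffAt n j (formAt n c j.1) = c j := by
  obtain ⟨i, k⟩ := j
  have hmon (k' : Fin (n i + 1)) :
      C (c ⟨i, k'⟩) * X 0 ^ (n i - (k' : ℕ)) * X 1 ^ (k' : ℕ) =
        monomial (Finsupp.single (0 : Fin 2) (n i - (k' : ℕ)) + Finsupp.single 1 (k' : ℕ))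
          (c ⟨i, k'⟩) := by
    rw [monomial_add_single, ← C_mul_X_pow_eq_monomial]
  simp only [coeffAt, formAt, hmon, coeff_sum, coeff_monomial]
  rw [Finset.sum_eq_single k]
  · simp
  · intro b _ hb
    refine if_neg fun h => hb (Fin.ext ?_)
    simpa using DFunLike.congr_fun h 1
  · simp

theorem formAt_pt_zero (a₀ a₁ b₀ b₁ c₀ c₁ c₂ c₃ : ℂ) :
    formAt ![1, 1, 3] (pt a₀ a₁ b₀ b₁ c₀ c₁ c₂ c₃) 0 = C a₀ * X 0 + C a₁ * X 1 := by
  change ∑ k : Fin 2, C (pt a₀ a₁ b₀ b₁ c₀ c₁ c₂ c₃ ⟨0, k⟩) * X 0 ^ (1 - (k : ℕ)) *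
    X 1 ^ (k : ℕ) = _
  rw [Fin.sum_univ_two]
  simp [pt]
  rfl

theorem formAt_pt_one (a₀ a₁ b₀ b₁ c₀ c₁ c₂ c₃ : ℂ) :
    formAt ![1, 1, 3] (pt a₀ a₁ b₀ b₁ c₀ c₁ c₂ c₃) 1 = C b₀ * X 0 + C b₁ * X 1 := by
  change ∑ k : Fin 2, C (pt a₀ a₁ b₀ b₁ c₀ c₁ c₂ c₃ ⟨1, k⟩) * X 0 ^ (1 - (k : ℕ)) *
    X 1 ^ (k : ℕ) = _
  rw [Fin.sum_univ_two]
  simp [pt]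
  rfl

theorem formAt_pt_two (a₀ a₁ b₀ b₁ c₀ c₁ c₂ c₃ : ℂ) :
    formAt ![1, 1, 3] (pt a₀ a₁ b₀ b₁ c₀ c₁ c₂ c₃) 2 =
      C c₀ * X 0 ^ 3 + C c₁ * X 0 ^ 2 * X 1 + C c₂ * X 0 * X 1 ^ 2 + C c₃ * X 1 ^ 3 := by
  change ∑ k : Fin 4, C (pt a₀ a₁ b₀ b₁ c₀ c₁ c₂ c₃ ⟨2, k⟩) * X 0 ^ (3 - (k : ℕ)) *
    X 1 ^ (k : ℕ) = _
  rw [Fin.sum_univ_four]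
  simp [pt]
  rfl

theorem actPt_eq_subst (g : Matrix.SpecialLinearGroup (Fin 2) ℂ) (c : Idx ![1, 1, 3] → ℂ) :
    actPt ![1, 1, 3] g c =
      subst ((↑g⁻¹ : Matrix (Fin 2) (Fin 2) ℂ) 0 0) ((↑g⁻¹ : Matrix (Fin 2) (Fin 2) ℂ) 0 1)
        ((↑g⁻¹ : Matrix (Fin 2) (Fin 2) ℂ) 1 0) ((↑g⁻¹ : Matrix (Fin 2) (Fin 2) ℂ) 1 1) c := by
  generalize hh : g⁻¹ = h
  suffices key : ∀ i, sl2Act g (formAt ![1, 1, 3] c i) =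
      formAt ![1, 1, 3] (subst (h.1 0 0) (h.1 0 1) (h.1 1 0) (h.1 1 1) c) i by
    funext j
    rw [actPt, key, coeffAt_formAt]
  obtain ⟨a₀, a₁, b₀, b₁, c₀, c₁, c₂, c₃, rfl⟩ := exists_eq_pt c
  rw [subst_pt]
  intro i
  rw [sl2Act, hh]
  fin_cases i
  · simp only [Fin.zero_eta, formAt_pt_zero]
    simp [Fin.sum_univ_two]
    ring
  · simp only [Fin.mk_one, formAt_pt_one]
    simp [Fin.sum_univ_two]
    ring
  · simp only [Fin.reduceFinMk, formAt_pt_two]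
    simp [Fin.sum_univ_two, map_ofNat]
    ring

section Parameters

variable {A B : Type*}

theorem vec_congr {x₀ x₁ x₂ x₃ x₄ y₀ y₁ y₂ y₃ y₄ : A} (h₀ : x₀ = y₀) (h₁ : x₁ = y₁)
    (h₂ : x₂ = y₂) (h₃ : x₃ = y₃) (h₄ : x₄ = y₄) :
    ![x₀, x₁, x₂, x₃, x₄] = ![y₀, y₁, y₂, y₃, y₄] := by
  rw [h₀, h₁, h₂, h₃, h₄]

variable [CommRing A] [CommRing B]

/-- The determinant of the two linear forms, the Hessian of the cubic at the first linear form,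
the sum of the cubic at the first and its Hessian at the second linear form, the cubic at the second
linear form and the discriminant of the cubic. -/
def params (v : Idx ![1, 1, 3] → A) : Fin 5 → A :=
  let a₀ := v ⟨0, (0 : Fin 2)⟩
  let a₁ := v ⟨0, (1 : Fin 2)⟩
  let b₀ := v ⟨1, (0 : Fin 2)⟩
  let b₁ := v ⟨1, (1 : Fin 2)⟩
  let c₀ := v ⟨2, (0 : Fin 4)⟩
  let c₁ := v ⟨2, (1 : Fin 4)⟩
  let c₂ := v ⟨2, (2 : Fin 4)⟩
  let c₃ := v ⟨2, (3 : Fin 4)⟩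
  ![a₀ * b₁ - a₁ * b₀,
    (c₁ ^ 2 - 3 * c₀ * c₂) * a₁ ^ 2 - (c₁ * c₂ - 9 * c₀ * c₃) * (a₀ * a₁) +
      (c₂ ^ 2 - 3 * c₁ * c₃) * a₀ ^ 2,
    c₃ * a₀ ^ 3 - c₂ * a₁ * a₀ ^ 2 + c₁ * a₁ ^ 2 * a₀ - c₀ * a₁ ^ 3 +
      ((c₁ ^ 2 - 3 * c₀ * c₂) * b₁ ^ 2 - (c₁ * c₂ - 9 * c₀ * c₃) * (b₀ * b₁) +
        (c₂ ^ 2 - 3 * c₁ * c₃) * b₀ ^ 2),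
    c₃ * b₀ ^ 3 - c₂ * b₁ * b₀ ^ 2 + c₁ * b₁ ^ 2 * b₀ - c₀ * b₁ ^ 3,
    c₁ ^ 2 * c₂ ^ 2 + 18 * c₀ * c₁ * c₂ * c₃ - 4 * c₀ * c₂ ^ 3 - 4 * c₁ ^ 3 * c₃ -
      27 * c₀ ^ 2 * c₃ ^ 2]

theorem params_pt (a₀ a₁ b₀ b₁ c₀ c₁ c₂ c₃ : A) :
    params (pt a₀ a₁ b₀ b₁ c₀ c₁ c₂ c₃) =
    ![a₀ * b₁ - a₁ * b₀,
      (c₁ ^ 2 - 3 * c₀ * c₂) * a₁ ^ 2 - (c₁ * c₂ - 9 * c₀ * c₃) * (a₀ * a₁) +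
        (c₂ ^ 2 - 3 * c₁ * c₃) * a₀ ^ 2,
      c₃ * a₀ ^ 3 - c₂ * a₁ * a₀ ^ 2 + c₁ * a₁ ^ 2 * a₀ - c₀ * a₁ ^ 3 +
        ((c₁ ^ 2 - 3 * c₀ * c₂) * b₁ ^ 2 - (c₁ * c₂ - 9 * c₀ * c₃) * (b₀ * b₁) +
          (c₂ ^ 2 - 3 * c₁ * c₃) * b₀ ^ 2),
      c₃ * b₀ ^ 3 - c₂ * b₁ * b₀ ^ 2 + c₁ * b₁ ^ 2 * b₀ - c₀ * b₁ ^ 3,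
      c₁ ^ 2 * c₂ ^ 2 + 18 * c₀ * c₁ * c₂ * c₃ - 4 * c₀ * c₂ ^ 3 - 4 * c₁ ^ 3 * c₃ -
        27 * c₀ ^ 2 * c₃ ^ 2] :=
  rfl

theorem map_params (φ : A →+* B) (v : Idx ![1, 1, 3] → A) :
    φ ∘ params v = params (φ ∘ v) := by
  obtain ⟨a₀, a₁, b₀, b₁, c₀, c₁, c₂, c₃, rfl⟩ := exists_eq_pt v
  rw [map_pt, params_pt, params_pt]
  funext j
  fin_cases j <;> simp [map_ofNat]

theorem params_subst {a b c d : A} (h : a * d - b * c = 1) (v : Idx ![1, 1, 3] → A) :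
    params (subst a b c d v) = params v := by
  have cancel (k : ℕ) (x y : A) (hxy : x = (a * d - b * c) ^ k * y) : x = y := by
    rw [hxy, h, one_pow, one_mul]
  have cancel₂ (k m : ℕ) (x y z : A)
      (hxy : x = (a * d - b * c) ^ k * y + (a * d - b * c) ^ m * z) : x = y + z := by
    rw [hxy, h, one_pow, one_pow, one_mul, one_mul]
  obtain ⟨a₀, a₁, b₀, b₁, c₀, c₁, c₂, c₃, rfl⟩ := exists_eq_pt v
  rw [subst_pt, params_pt, params_pt]
  exact vec_congr (cancel 1 _ _ (by ring)) (cancel 4 _ _ (by ring)) (cancel₂ 3 4 _ _ _ (by ring))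
    (cancel 3 _ _ (by ring)) (cancel 6 _ _ (by ring))

end Parameters

theorem det_coe_inv (g : Matrix.SpecialLinearGroup (Fin 2) ℂ) :
    (↑g⁻¹ : Matrix (Fin 2) (Fin 2) ℂ) 0 0 * (↑g⁻¹ : Matrix (Fin 2) (Fin 2) ℂ) 1 1 -
      (↑g⁻¹ : Matrix (Fin 2) (Fin 2) ℂ) 0 1 * (↑g⁻¹ : Matrix (Fin 2) (Fin 2) ℂ) 1 0 = 1 := by
  rw [← Matrix.det_fin_two, Matrix.SpecialLinearGroup.det_coe]

/-- The candidate system of parameters. -/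
noncomputable def hsop : Fin 5 → MvPolynomial (Idx ![1, 1, 3]) ℂ := params X

theorem aeval_hsop {A : Type*} [CommRing A] [Algebra ℂ A] (v : Idx ![1, 1, 3] → A) (j : Fin 5) :
    aeval v (hsop j) = params v j := by
  have := congrFun (map_params (aeval v : MvPolynomial (Idx ![1, 1, 3]) ℂ →ₐ[ℂ] A).toRingHom X) j
  refine this.trans (congrArg (fun w => params w j) (funext fun i => ?_))
  simp

theorem hsop_mem_invariantRing (j : Fin 5) : hsop j ∈ invariantRing ![1, 1, 3] := by
  intro g c
  rw [← coe_aeval_eq_eval, ← coe_aeval_eq_eval, RingHom.coe_coe, RingHom.coe_coe, aeval_hsop,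
    aeval_hsop, actPt_eq_subst, params_subst (det_coe_inv g)]

theorem hsop_isHomogeneous (j : Fin 5) :
    (hsop j).IsHomogeneous ((![2, 4, 4, 4, 4] : Fin 5 → ℕ) j) := by
  have hX (i : Idx ![1, 1, 3]) : (X i : MvPolynomial (Idx ![1, 1, 3]) ℂ).IsHomogeneous 1 :=
    isHomogeneous_X _ _
  have hN (n : ℕ) [n.AtLeastTwo] :
      (OfNat.ofNat n : MvPolynomial (Idx ![1, 1, 3]) ℂ).IsHomogeneous 0 := by
    rw [← map_ofNat C n]
    exact isHomogeneous_C _ _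
  fin_cases j
  · exact ((hX _).mul (hX _)).sub ((hX _).mul (hX _))
  · exact (((((hX _).pow 2).sub (((hN 3).mul (hX _)).mul (hX _))).mul ((hX _).pow 2)).sub
      ((((hX _).mul (hX _)).sub (((hN 9).mul (hX _)).mul (hX _))).mul ((hX _).mul (hX _)))).add
      ((((hX _).pow 2).sub (((hN 3).mul (hX _)).mul (hX _))).mul ((hX _).pow 2))
  · exact (((((hX _).mul ((hX _).pow 3)).sub (((hX _).mul (hX _)).mul ((hX _).pow 2))).add
      (((hX _).mul ((hX _).pow 2)).mul (hX _))).sub ((hX _).mul ((hX _).pow 3))).add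
      ((((((hX _).pow 2).sub (((hN 3).mul (hX _)).mul (hX _))).mul ((hX _).pow 2)).sub
      ((((hX _).mul (hX _)).sub (((hN 9).mul (hX _)).mul (hX _))).mul ((hX _).mul (hX _)))).add
      ((((hX _).pow 2).sub (((hN 3).mul (hX _)).mul (hX _))).mul ((hX _).pow 2)))
  · exact ((((hX _).mul ((hX _).pow 3)).sub (((hX _).mul (hX _)).mul ((hX _).pow 2))).add
      (((hX _).mul ((hX _).pow 2)).mul (hX _))).sub ((hX _).mul ((hX _).pow 3))
  · exact ((((((hX _).pow 2).mul ((hX _).pow 2)).add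
      (((((hN 18).mul (hX _)).mul (hX _)).mul (hX _)).mul (hX _))).sub
      (((hN 4).mul (hX _)).mul ((hX _).pow 3))).sub
      (((hN 4).mul ((hX _).pow 3)).mul (hX _))).sub
      (((hN 27).mul ((hX _).pow 2)).mul ((hX _).pow 2))

variable {P : MvPolynomial (Idx ![1, 1, 3]) ℂ}

theorem aeval_subst_complex (hP : P ∈ invariantRing ![1, 1, 3]) {a b c d : ℂ}
    (h : a * d - b * c = 1) (v : Idx ![1, 1, 3] → ℂ) :
    aeval (subst a b c d v) P = aeval v P := by
  obtain ⟨g, hg⟩ : ∃ g : Matrix.SpecialLinearGroup (Fin 2) ℂ, g.1 = !![a, b; c, d] :=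
    ⟨⟨!![a, b; c, d], by rw [Matrix.det_fin_two_of, h]⟩, rfl⟩
  have := hP g⁻¹ v
  rw [actPt_eq_subst, inv_inv, hg] at this
  exact this

/-- The substitution by a product of four alternating elementary matrices. -/
def shear {A : Type*} [CommRing A] (r s t q : A) (v : Idx ![1, 1, 3] → A) : Idx ![1, 1, 3] → A :=
  subst ((1 + r * s) * (1 + t * q) + r * q) ((1 + r * s) * t + r)
    (s * (1 + t * q) + q) (s * t + 1) v

theorem map_shear {A B : Type*} [CommRing A] [CommRing B] (φ : A →+* B) (r s t q : A)
    (v : Idx ![1, 1, 3] → A) :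
    φ ∘ shear r s t q v = shear (φ r) (φ s) (φ t) (φ q) (φ ∘ v) := by
  rw [shear, map_subst, shear]
  simp only [map_add, map_mul, map_one]

theorem aeval_shear (hP : P ∈ invariantRing ![1, 1, 3])
    {A : Type*} [CommRing A] [Algebra ℂ A] (r s t q : A) (v : Idx ![1, 1, 3] → A) :
    aeval (shear r s t q v) P = aeval v P := by
  let x (i : Fin 4) : MvPolynomial (Fin 4 ⊕ Idx ![1, 1, 3]) ℂ := X (Sum.inl i)
  let y (j : Idx ![1, 1, 3]) : MvPolynomial (Fin 4 ⊕ Idx ![1, 1, 3]) ℂ := X (Sum.inr j)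
  have key : aeval (shear (x 0) (x 1) (x 2) (x 3) y) P = aeval y P := by
    refine MvPolynomial.funext fun w => ?_
    have hw := map_shear (aeval w : MvPolynomial (Fin 4 ⊕ Idx ![1, 1, 3]) ℂ →ₐ[ℂ] ℂ).toRingHom
      (x 0) (x 1) (x 2) (x 3) y
    simp only [← coe_aeval_eq_eval, RingHom.coe_coe, comp_aeval_apply]
    refine (congrArg (fun u => aeval u P) hw).trans ?_
    rw [shear, aeval_subst_complex hP (by ring)]
    rfl
  have hw := map_shear (aeval (Sum.elim ![r, s, t, q] v) :
    MvPolynomial (Fin 4 ⊕ Idx ![1, 1, 3]) ℂ →ₐ[ℂ] A).toRingHom (x 0) (x 1) (x 2) (x 3) y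
  have := congrArg (aeval (Sum.elim ![r, s, t, q] v)) key
  simp only [comp_aeval_apply] at this
  replace this := (congrArg (fun u => aeval u P) hw).symm.trans this
  simpa [x, y, Function.comp_def] using this

theorem aeval_subst_eq (hP : P ∈ invariantRing ![1, 1, 3])
    {K : Type*} [Field K] [Algebra ℂ K] {a b c d : K} (h : a * d - b * c = 1)
    (v : Idx ![1, 1, 3] → K) : aeval (subst a b c d v) P = aeval v P := by
  rcases eq_or_ne c 0 with rfl | hc
  · have hd : d ≠ 0 := by
      rintro rfl
      simp at h
    rw [← aeval_shear hP ((a + b - 1) / d) d ((d - 1) / d) (-1) v]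
    refine congrArg (fun u => aeval u P) ?_
    rw [shear]
    congr 1
    · field_simp; linear_combination h
    · field_simp; linear_combination -h
    · field_simp; ring
    · field_simp; ring
  · rw [← aeval_shear hP ((a - 1) / c) c ((d - 1) / c) 0 v]
    refine congrArg (fun u => aeval u P) ?_
    rw [shear]
    congr 1
    · field_simp; ring
    · field_simp; linear_combination -h
    · ring
    · field_simp; ring

theorem pt_congr {A : Type*} {a₀ a₁ b₀ b₁ c₀ c₁ c₂ c₃ c₀' c₁' c₂' c₃' : A} [CommRing A]
    (h₀ : c₀ = c₀') (h₁ : c₁ = c₁') (h₂ : c₂ = c₂') (h₃ : c₃ = c₃') :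
    pt a₀ a₁ b₀ b₁ c₀ c₁ c₂ c₃ = pt a₀ a₁ b₀ b₁ c₀' c₁' c₂' c₃' := by
  rw [h₀, h₁, h₂, h₃]

theorem exists_subst_eq_normalForm {K : Type*} [Field K] [IsAlgClosed K]
    {a₀ a₁ b₀ b₁ c₀ c₁ c₂ c₃ : K} (h₀ : c₀ ≠ 0)
    (hdisc : params (pt a₀ a₁ b₀ b₁ c₀ c₁ c₂ c₃) 4 ≠ 0) :
    ∃ a b c d l : K, a * d - b * c = 1 ∧ ∃ x₀ x₁ y₀ y₁ : K,
      subst a b c d (pt a₀ a₁ b₀ b₁ c₀ c₁ c₂ c₃) = pt x₀ x₁ y₀ y₁ 0 (-l) (-l) 0 := by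
  let Q : Cubic K := ⟨c₀, c₁, c₂, c₃⟩
  obtain ⟨r, s, t, hrst⟩ := (Cubic.splits_iff_roots_eq_three (P := Q) (φ := RingHom.id K) h₀).1
    (IsAlgClosed.splits _)
  have h₁ : c₁ = c₀ * -(r + s + t) := Cubic.b_eq_three_roots (P := Q) (φ := RingHom.id K) h₀ hrst
  have h₂ : c₂ = c₀ * (r * s + r * t + s * t) :=
    Cubic.c_eq_three_roots (P := Q) (φ := RingHom.id K) h₀ hrst
  have h₃ : c₃ = c₀ * -(r * s * t) := Cubic.d_eq_three_roots (P := Q) (φ := RingHom.id K) h₀ hrst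
  clear_value Q
  subst h₁ h₂ h₃
  have hne : (r - s) * (s - t) * (t - r) ≠ 0 := by
    intro h
    refine hdisc ?_
    have : params (pt a₀ a₁ b₀ b₁ c₀ (c₀ * -(r + s + t)) (c₀ * (r * s + r * t + s * t))
        (c₀ * -(r * s * t))) 4 = c₀ ^ 4 * ((r - s) * (s - t) * (t - r)) ^ 2 := by
      rw [params_pt]
      simp only [Matrix.cons_val]
      ring
    rw [this, h]
    ring
  obtain ⟨k, hk⟩ := IsAlgClosed.exists_pow_nat_eq ((r - s) * (s - t) * (t - r))⁻¹ two_pos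
  refine ⟨-s * (k * (t - r)), r * (k * (s - t)), -(k * (t - r)), k * (s - t),
    c₀ * k ^ 3 * ((r - s) * (s - t) * (t - r)) ^ 2, ?_, _, _, _, _,
    (subst_pt ..).trans (pt_congr ?_ ?_ ?_ ?_)⟩
  · have hk' : k ^ 2 * ((r - s) * (s - t) * (t - r)) = 1 := by rw [hk, inv_mul_cancel₀ hne]
    linear_combination hk'
  all_goals ring

theorem aeval_mem_valuationSubring {K : Type*} [Field K] [Algebra ℂ K] [IsAlgClosed K]
    (V : ValuationSubring K) (hV : ∀ z : ℂ, algebraMap ℂ K z ∈ V) {ξ : Idx ![1, 1, 3] → K}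
    (h₀ : ξ ⟨2, (0 : Fin 4)⟩ ≠ 0) (hdisc : params ξ 4 ≠ 0) (hξ : ∀ j, params ξ j ∈ V)
    {P : MvPolynomial (Idx ![1, 1, 3]) ℂ} (hP : P ∈ invariantRing ![1, 1, 3]) :
    aeval ξ P ∈ V := by
  obtain ⟨η, hη, hPη⟩ : ∃ η : Idx ![1, 1, 3] → K, (∀ i, η i ∈ V) ∧ aeval η P = aeval ξ P := by
    obtain ⟨a₀, a₁, b₀, b₁, c₀, c₁, c₂, c₃, rfl⟩ := exists_eq_pt ξ
    obtain ⟨a, b, c, d, l, hdet, x₀, x₁, y₀, y₁, hnf⟩ :=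
      exists_subst_eq_normalForm (c₀ := c₀) h₀ hdisc
    rw [← aeval_subst_eq hP hdet, hnf]
    rw [← params_subst hdet, hnf, params_pt] at hξ
    simp only [← V.valuation_le_one_iff] at hξ ⊢
    have hl : V.valuation l ≤ 1 := by
      rw [← pow_le_one_iff_of_nonneg zero_le four_ne_zero, ← map_pow]
      convert hξ 4 using 2
      simp only [Matrix.cons_val]
      ring
    obtain ⟨a', b', c', d', hdet', ⟨h₁, h₂⟩, ⟨h₃, h₄⟩, h₅, h₆, h₇, h₈⟩ :=
      Valuation.hasIntegralModel (v := V.valuation) (a₀ := x₀) (a₁ := x₁) (b₀ := y₀) (b₁ := y₁) hl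
        (hξ 0)
        (by convert hξ 1 using 2; simp only [Matrix.cons_val]; ring)
        (by convert hξ 3 using 2; simp only [Matrix.cons_val]; ring)
        (by convert hξ 2 using 2; simp only [Matrix.cons_val]; ring)
    refine ⟨_, ?_, aeval_subst_eq hP hdet' _⟩
    rw [subst_pt, forall_idx]
    refine ⟨⟨h₁, h₂⟩, ⟨h₃, h₄⟩, ?_, ?_, ?_, ?_⟩
    · convert h₅ using 2
      change 0 * a' ^ 3 + -l * (a' ^ 2 * c') + -l * (a' * c' ^ 2) + 0 * c' ^ 3 = _
      ring
    · convert h₆ using 2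
      change 0 * (3 * a' ^ 2 * b') + -l * (2 * a' * b' * c' + a' ^ 2 * d') +
        -l * (2 * a' * c' * d' + b' * c' ^ 2) + 0 * (3 * c' ^ 2 * d') = _
      ring
    · convert h₇ using 2
      change 0 * (3 * a' * b' ^ 2) + -l * (b' ^ 2 * c' + 2 * a' * b' * d') +
        -l * (a' * d' ^ 2 + 2 * b' * c' * d') + 0 * (3 * c' * d' ^ 2) = _
      ring
    · convert h₈ using 2
      change 0 * b' ^ 3 + -l * (b' ^ 2 * d') + -l * (b' * d' ^ 2) + 0 * d' ^ 3 = _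
      ring
  rw [← hPη]
  clear hP hPη
  induction P using MvPolynomial.induction_on with
  | C z => simpa using hV z
  | add p q hp hq => simpa using add_mem hp hq
  | mul_X p i hp => simpa using mul_mem hp (hη i)

theorem isIntegral_of_mem_invariantRing {P : MvPolynomial (Idx ![1, 1, 3]) ℂ}
    (hP : P ∈ invariantRing ![1, 1, 3]) :
    IsIntegral (↥(Algebra.adjoin ℂ (Set.range hsop))) P := by
  let S := MvPolynomial (Idx ![1, 1, 3]) ℂ
  let K := AlgebraicClosure (FractionRing S)
  let A := Algebra.adjoin ℂ (Set.range hsop)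
  have hinj : Function.Injective (algebraMap S K) := by
    rw [IsScalarTower.algebraMap_eq S (FractionRing S) K]
    exact (algebraMap (FractionRing S) K).injective.comp (IsFractionRing.injective S _)
  rw [← isIntegral_algebraMap_iff (B := K) hinj]
  by_contra hx
  obtain ⟨V, hV, hxV⟩ := Subring.exists_le_valuationSubring_of_isIntegrallyClosedIn
    (R := (integralClosure A K).toSubring) (x := algebraMap S K P) hx
  refine hxV ?_
  have hA (z : A) : algebraMap S K z ∈ V := hV (isIntegral_algebraMap (R := A) (A := K) (x := z))
  let ξ : Idx ![1, 1, 3] → K := fun i => algebraMap S K (X i)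
  have hmap (Q : S) : aeval ξ Q = algebraMap S K Q := by
    rw [← aeval_X_left_apply (R := ℂ) Q, ← aeval_algebraMap_apply, aeval_X_left_apply]
    rfl
  have hpar (j) : params ξ j = algebraMap S K (hsop j) := by rw [← aeval_hsop, hmap]
  rw [← hmap]
  refine aeval_mem_valuationSubring V ?_ ?_ ?_ ?_ hP
  · intro z
    rw [IsScalarTower.algebraMap_apply ℂ S K]
    exact hA (algebraMap ℂ A z)
  · exact (map_ne_zero_iff _ hinj).2 (X_ne_zero _)
  · rw [hpar]
    refine (map_ne_zero_iff _ hinj).2 fun h0 => ?_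
    have := aeval_hsop (pt 0 0 0 0 0 1 1 0 : Idx ![1, 1, 3] → ℂ) 4
    rw [h0, params_pt] at this
    simp at this
  · intro j
    rw [hpar]
    exact hA ⟨hsop j, Algebra.subset_adjoin ⟨j, rfl⟩⟩

section SecondParameters

variable {A B : Type*} [CommRing A] [CommRing B]

/-- The determinant of the two linear forms and the polarizations of the cubic evaluated at the
linear forms. -/
def polarParams (v : Idx ![1, 1, 3] → A) : Fin 5 → A :=
  let a₀ := v ⟨0, (0 : Fin 2)⟩
  let a₁ := v ⟨0, (1 : Fin 2)⟩
  let b₀ := v ⟨1, (0 : Fin 2)⟩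
  let b₁ := v ⟨1, (1 : Fin 2)⟩
  let c₀ := v ⟨2, (0 : Fin 4)⟩
  let c₁ := v ⟨2, (1 : Fin 4)⟩
  let c₂ := v ⟨2, (2 : Fin 4)⟩
  let c₃ := v ⟨2, (3 : Fin 4)⟩
  ![a₀ * b₁ - a₁ * b₀,
    c₃ * a₀ ^ 3 - c₂ * a₁ * a₀ ^ 2 + c₁ * a₁ ^ 2 * a₀ - c₀ * a₁ ^ 3,
    c₃ * (3 * a₀ ^ 2 * b₀) - c₂ * (a₀ ^ 2 * b₁ + 2 * a₀ * b₀ * a₁) +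
      c₁ * (a₁ ^ 2 * b₀ + 2 * a₁ * b₁ * a₀) - c₀ * (3 * a₁ ^ 2 * b₁),
    c₃ * (3 * b₀ ^ 2 * a₀) - c₂ * (b₀ ^ 2 * a₁ + 2 * b₀ * a₀ * b₁) +
      c₁ * (b₁ ^ 2 * a₀ + 2 * b₁ * a₁ * b₀) - c₀ * (3 * b₁ ^ 2 * a₁),
    c₃ * b₀ ^ 3 - c₂ * b₁ * b₀ ^ 2 + c₁ * b₁ ^ 2 * b₀ - c₀ * b₁ ^ 3]

theorem polarParams_pt (a₀ a₁ b₀ b₁ c₀ c₁ c₂ c₃ : A) :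
    polarParams (pt a₀ a₁ b₀ b₁ c₀ c₁ c₂ c₃) =
    ![a₀ * b₁ - a₁ * b₀,
      c₃ * a₀ ^ 3 - c₂ * a₁ * a₀ ^ 2 + c₁ * a₁ ^ 2 * a₀ - c₀ * a₁ ^ 3,
      c₃ * (3 * a₀ ^ 2 * b₀) - c₂ * (a₀ ^ 2 * b₁ + 2 * a₀ * b₀ * a₁) +
        c₁ * (a₁ ^ 2 * b₀ + 2 * a₁ * b₁ * a₀) - c₀ * (3 * a₁ ^ 2 * b₁),
      c₃ * (3 * b₀ ^ 2 * a₀) - c₂ * (b₀ ^ 2 * a₁ + 2 * b₀ * a₀ * b₁) +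
        c₁ * (b₁ ^ 2 * a₀ + 2 * b₁ * a₁ * b₀) - c₀ * (3 * b₁ ^ 2 * a₁),
      c₃ * b₀ ^ 3 - c₂ * b₁ * b₀ ^ 2 + c₁ * b₁ ^ 2 * b₀ - c₀ * b₁ ^ 3] :=
  rfl

theorem map_polarParams (φ : A →+* B) (v : Idx ![1, 1, 3] → A) :
    φ ∘ polarParams v = polarParams (φ ∘ v) := by
  obtain ⟨a₀, a₁, b₀, b₁, c₀, c₁, c₂, c₃, rfl⟩ := exists_eq_pt v
  rw [map_pt, polarParams_pt, polarParams_pt]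
  funext j
  fin_cases j <;> simp [map_ofNat]

theorem polarParams_subst {a b c d : A} (h : a * d - b * c = 1) (v : Idx ![1, 1, 3] → A) :
    polarParams (subst a b c d v) = polarParams v := by
  have cancel (k : ℕ) (x y : A) (hxy : x = (a * d - b * c) ^ k * y) : x = y := by
    rw [hxy, h, one_pow, one_mul]
  obtain ⟨a₀, a₁, b₀, b₁, c₀, c₁, c₂, c₃, rfl⟩ := exists_eq_pt v
  rw [subst_pt, polarParams_pt, polarParams_pt]
  exact vec_congr (cancel 1 _ _ (by ring)) (cancel 3 _ _ (by ring)) (cancel 3 _ _ (by ring))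
    (cancel 3 _ _ (by ring)) (cancel 3 _ _ (by ring))

end SecondParameters

theorem aeval_polarParams {A : Type*} [CommRing A] [Algebra ℂ A] (v : Idx ![1, 1, 3] → A)
    (j : Fin 5) :
    aeval v (polarParams (X : Idx ![1, 1, 3] → MvPolynomial (Idx ![1, 1, 3]) ℂ) j) =
      polarParams v j := by
  have := congrFun
    (map_polarParams (aeval v : MvPolynomial (Idx ![1, 1, 3]) ℂ →ₐ[ℂ] A).toRingHom X) j
  refine this.trans (congrArg (fun w => polarParams w j) (funext fun i => ?_))
  simp

theorem polarParams_mem_invariantRing (j : Fin 5) :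
    polarParams (X : Idx ![1, 1, 3] → MvPolynomial (Idx ![1, 1, 3]) ℂ) j ∈
      invariantRing ![1, 1, 3] := by
  intro g c
  rw [← coe_aeval_eq_eval, ← coe_aeval_eq_eval, RingHom.coe_coe, RingHom.coe_coe,
    aeval_polarParams, aeval_polarParams, actPt_eq_subst, polarParams_subst (det_coe_inv g)]

theorem algebraicIndependent_polarParams : AlgebraicIndependent ℂ
    (polarParams (X : Idx ![1, 1, 3] → MvPolynomial (Idx ![1, 1, 3]) ℂ)) := by
  rw [algebraicIndependent_iff]
  intro p hp
  have hv (v : Idx ![1, 1, 3] → ℂ) : aeval (polarParams v) p = 0 := by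
    have := congrArg (aeval v) hp
    rw [comp_aeval_apply, map_zero] at this
    simpa only [aeval_polarParams] using this
  refine (mul_eq_zero.1 (?_ : X 0 * p = 0)).resolve_left (X_ne_zero _)
  refine MvPolynomial.funext fun e => ?_
  rw [map_mul, eval_X, map_zero, mul_eq_zero, or_iff_not_imp_left]
  intro he
  have := hv (pt 1 0 0 (e 0) (-(e 4) / e 0 ^ 3) (e 3 / e 0 ^ 2) (-(e 2) / e 0) (e 1))
  rw [polarParams_pt] at this
  rw [← coe_aeval_eq_eval, RingHom.coe_coe, ← this]
  refine congrArg (fun u => aeval u p) (funext fun j => ?_)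
  fin_cases j <;> simp <;> field_simp

theorem algebraicIndependent_hsop : AlgebraicIndependent ℂ hsop := by
  let R := invariantRing ![1, 1, 3]
  let S := MvPolynomial (Idx ![1, 1, 3]) ℂ
  let y : Fin 5 → R := fun j => ⟨hsop j, hsop_mem_invariantRing j⟩
  let x : Fin 5 → R := fun j => ⟨_, polarParams_mem_invariantRing j⟩
  have hx : AlgebraicIndependent ℂ x :=
    (R.val.algebraicIndependent_iff Subtype.val_injective).1 algebraicIndependent_polarParams
  let B := Algebra.adjoin ℂ (Set.range y)
  have hB : Algebra.adjoin ℂ (Set.range hsop) = B.map R.val := by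
    rw [AlgHom.map_adjoin, ← Set.range_comp]
    rfl
  have hint : Algebra.IsIntegral B R := by
    refine ⟨fun z => ?_⟩
    rw [← isIntegral_algebraMap_iff (B := S) Subtype.val_injective]
    have hz := isIntegral_of_mem_invariantRing z.2
    rw [hB] at hz
    exact hz.map_of_comp_eq
      (B.equivMapOfInjective R.val Subtype.val_injective).symm.toRingEquiv.toRingHom
      (RingHom.id S) (by
        ext1 w
        obtain ⟨w, rfl⟩ := (B.equivMapOfInjective R.val Subtype.val_injective).surjective w
        simp
        rfl)
  have : FaithfulSMul ℂ R :=
    (faithfulSMul_iff_algebraMap_injective ℂ R).2 (algebraMap ℂ R).injective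
  have halg : Algebra.IsAlgebraic B R := ⟨fun z => (hint.isIntegral z).isAlgebraic⟩
  have := Algebra.IsAlgebraic.isTranscendenceBasis_of_lift_le_trdeg_of_finite ℂ y (by
    simpa using hx.lift_cardinalMk_le_trdeg)
  exact this.1.map' (f := R.val) Subtype.val_injective

end BinInv

open BinInv in
/-- For `V = 2V₁ ⊕ V₃`, the invariant ring has a homogeneous system of parameters
of degrees `2, 4, 4, 4, 4`. -/
theorem hsop_2V1_V3 :
    ∃ P : Fin 5 → MvPolynomial (Idx ![1, 1, 3]) ℂ,
      IsHSOP ![1, 1, 3] P ![2, 4, 4, 4, 4] := by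
  refine ⟨hsop, hsop_mem_invariantRing, fun j => ?_, hsop_isHomogeneous,
    algebraicIndependent_hsop, fun x hx => isIntegral_of_mem_invariantRing hx⟩
  fin_cases j <;> decide
end
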